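/- (Removal of coprimality conditions.) Let s ∈ ℂ with Re(s) > 3/2 and let α, β, r ∈ ℤ[ω] with α, β ≡ 1 (mod 3), μ(α)² = 1, and (α, βr) = 1. Then: (i) ψ_{αβ}(α²r, s) · Δ_α(s) = ψ_β(α²r, s); (ii) ψ_{αβ}(αr, s) · Δ_α(s) = ∑_{d ∈ ℤ[ω], d ≡ 1 (mod 3), d ∣ α} μ(d) N(d)^{1−2s} conj(g₃(αr/d, d)) ψ_β(αr/d, s); (iii) ψ_{αβ}(r, s) · Δ_α(s) = ∑_{d ∈ ℤ[ω], d ≡ 1 (mod 3), d ∣ α} μ(d) N(d)^{−s} g₃(r, d) ψ_β(rd, s). -/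

import Mathlib

noncomputable section

open Complex

namespace CubicPaper

/-- `ω = e^{2πi/3}`. -/
def ωc : ℂ := Complex.exp (2 * Real.pi * Complex.I / 3)

/-- The ring of Eisenstein integers `ℤ[ω]`, realized as a subring of `ℂ`. -/
def Eis : Subring ℂ := Subring.closure {ωc}

/-- `ω` as an Eisenstein integer. -/
def ωE : Eis := ⟨ωc, Subring.subset_closure (Set.mem_singleton _)⟩

/-- The ramified prime `λ = 1 + 2ω`. -/
def lam : Eis := 1 + 2 * ωE

/-- The norm `N(x) = |x|²`. -/
def Nm (x : Eis) : ℝ := Complex.normSq (x : ℂ)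

/-- The norm as a natural number. -/
def NmN (x : Eis) : ℕ := ⌊Nm x⌋₊

/-- `Rep x` : `x` is the canonical generator `λ^k c`, `c ≡ 1 (mod 3)`, of a nonzero ideal;
nonzero ideals of `ℤ[ω]` are in bijection with elements satisfying `Rep`. -/
def Rep (x : Eis) : Prop := ∃ (k : ℕ) (c : Eis), (3 : Eis) ∣ (c - 1) ∧ x = lam ^ k * c

/-- `ě(z) = e^{2πi(z + z̄)}`. -/
def eE (z : ℂ) : ℂ := Complex.exp (2 * Real.pi * Complex.I * (z + (starRingEnd ℂ) z))

/-- Characterizing axioms of the cubic residue symbol; `χ b a` denotes `(a/b)₃`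
(the lower entry `b ≡ 1 (mod 3)` comes first). -/
structure IsCubicSymbol (χ : Eis → Eis → Eis) : Prop where
  one_bot : ∀ a, χ 1 a = 1
  mul_bot : ∀ b₁ b₂ a, (3 : Eis) ∣ (b₁ - 1) → (3 : Eis) ∣ (b₂ - 1) →
    χ (b₁ * b₂) a = χ b₁ a * χ b₂ a
  prime_vals : ∀ π a, Prime π → (3 : Eis) ∣ (π - 1) →
    χ π a = 0 ∨ χ π a = 1 ∨ χ π a = ωE ∨ χ π a = ωE ^ 2
  prime_congr : ∀ π a, Prime π → (3 : Eis) ∣ (π - 1) →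
    π ∣ (a ^ ((NmN π - 1) / 3) - χ π a)
  prime_eq_zero : ∀ π a, Prime π → (3 : Eis) ∣ (π - 1) → (χ π a = 0 ↔ π ∣ a)

/-- Characterizing axioms of the Möbius function on `ℤ[ω]`. -/
structure IsMoebius (μ : Eis → ℤ) : Prop where
  isUnit : ∀ u : Eis, IsUnit u → μ u = 1
  prime_mul : ∀ p x, Prime p → ¬ p ∣ x → μ (p * x) = - μ x
  eq_zero : ∀ x : Eis, ¬ Squarefree x → μ x = 0

/-- The cubic Gauss sum `g₃(m, c) = ∑_{d mod c} χ_c(d) ě(md/c)`. -/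
def g₃ (χ : Eis → Eis → Eis) (m c : Eis) : ℂ :=
  ∑ᶠ d : Eis ⧸ Ideal.span {c}, ((χ c d.out : Eis) : ℂ) * eE (((m * d.out : Eis) : ℂ) / (c : ℂ))

/-- The normalized cubic Gauss sum `g̃₃(m, c) = N(c)^{-1/2} g₃(m, c)`. -/
def g₃n (χ : Eis → Eis → Eis) (m c : Eis) : ℂ :=
  ((Real.sqrt (Nm c) : ℂ))⁻¹ * g₃ χ m c

/-- Euler's totient on `ℤ[ω]`. -/
def phiE (b : Eis) : ℕ := Nat.card {x : Eis ⧸ Ideal.span {b} // IsUnit x}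

/-- The kernel `Φ_j(y) = (1/2πi)∫_{(2)} (2π)^{-jw} y^{-w} (Γ(1/2+w)/Γ(1/2))^j dw/w`. -/
def Φ (j : ℕ) (y : ℝ) : ℂ :=
  (1 / (2 * Real.pi)) * ∫ t : ℝ,
    (2 * Real.pi : ℂ) ^ (-((j : ℂ) * (2 + t * Complex.I))) *
    (y : ℂ) ^ (-(2 + t * Complex.I)) *
    (Complex.Gamma (1 / 2 + (2 + t * Complex.I)) / Complex.Gamma (1 / 2)) ^ j /
    (2 + t * Complex.I)

/-- `A₁(q)`, the sum appearing in the approximate functional equation for `L(1/2, χ_q)`. -/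
def A₁ (χ : Eis → Eis → Eis) (q : Eis) : ℂ :=
  ∑' n : {x : Eis // Rep x},
    ((χ q n.1 : Eis) : ℂ) * (Nm n.1 : ℂ) ^ (-(1/2 : ℂ)) *
      Φ 1 (Nm n.1 / Real.sqrt (3 * Nm q))

/-- `A₂(q)`, the double sum appearing in the approximate functional equation for
`|L(1/2, χ_q)|²`. -/
def A₂ (χ : Eis → Eis → Eis) (q : Eis) : ℂ :=
  ∑' p : {x : Eis // Rep x} × {x : Eis // Rep x},
    ((χ q p.1.1 : Eis) : ℂ) * (starRingEnd ℂ) ((χ q p.2.1 : Eis) : ℂ) *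
      ((Nm p.1.1 * Nm p.2.1 : ℝ) : ℂ) ^ (-(1/2 : ℂ)) *
      Φ 2 (Nm p.1.1 * Nm p.2.1 / (3 * Nm q))

/-- `M_Y(q) = ∑_{𝔩² ∣ q, N(𝔩) ≤ Y} μ(𝔩)` (sum over nonzero ideals `𝔩`, i.e. over
canonical generators). -/
def MY (μ : Eis → ℤ) (Y : ℝ) (q : Eis) : ℤ :=
  ∑ᶠ l ∈ {l : Eis | Rep l ∧ l ^ 2 ∣ q ∧ Nm l ≤ Y}, μ l

/-- `R_Y(q) = ∑_{𝔩² ∣ q, N(𝔩) > Y} μ(𝔩)`. -/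
def RY (μ : Eis → ℤ) (Y : ℝ) (q : Eis) : ℤ :=
  ∑ᶠ l ∈ {l : Eis | Rep l ∧ l ^ 2 ∣ q ∧ Y < Nm l}, μ l

/-- The mollifier `𝓜(q) = ∑_𝔟 λ(𝔟) √N(𝔟) χ_q(𝔟)` attached to coefficients `lm`
(supported on canonical generators of squarefree ideals coprime to 3). -/
def Moll (χ : Eis → Eis → Eis) (lm : Eis → ℂ) (q : Eis) : ℂ :=
  ∑ᶠ b : Eis, lm b * (Real.sqrt (Nm b) : ℂ) * ((χ q b : Eis) : ℂ)

/-- `𝒮_M(β; F) = ∑_{q ≡ 1 (9)} M_Y(q) β_q F(N(q)/X)`. -/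
def SM (μ : Eis → ℤ) (Y X : ℝ) (F : ℝ → ℝ) (β : Eis → ℂ) : ℂ :=
  ∑ᶠ q ∈ {q : Eis | (9 : Eis) ∣ (q - 1)}, (MY μ Y q : ℂ) * β q * (F (Nm q / X) : ℂ)

/-- `𝒮_R(|β|; F) = ∑_{q ≡ 1 (9)} |R_Y(q)| ‖β_q‖ F(N(q)/X)`. -/
def SR (μ : Eis → ℤ) (Y X : ℝ) (F : ℝ → ℝ) (β : Eis → ℂ) : ℝ :=
  ∑ᶠ q ∈ {q : Eis | (9 : Eis) ∣ (q - 1)}, |(RY μ Y q : ℝ)| * ‖β q‖ * F (Nm q / X)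

/-- A test function: Schwartz (here: smooth), compactly supported in `(1,2)`,
with `0 ≤ F ≤ 1`. -/
structure IsTestFn (F : ℝ → ℝ) : Prop where
  smooth : ContDiff ℝ (⊤ : ℕ∞) F
  supp : ∀ t, F t ≠ 0 → 1 < t ∧ t < 2
  nonneg : ∀ t, 0 ≤ F t
  le_one : ∀ t, F t ≤ 1

/-- `F̌(0) = ∫₀^∞ F(t) dt`. -/
def Fcheck0 (F : ℝ → ℝ) : ℝ := ∫ t in Set.Ioi (0:ℝ), F t

/-- `F̌'(0) = ∫₀^∞ F(t) log t dt`. -/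
def Fcheck'0 (F : ℝ → ℝ) : ℝ := ∫ t in Set.Ioi (0:ℝ), F t * Real.log t

/-- The Dedekind zeta function of `ℚ(ω)` (at real `s > 1`). -/
def zetaK (s : ℝ) : ℝ := ∑' n : {x : Eis // Rep x}, (Nm n.1) ^ (-s)

/-- Product of `f(N(𝔭))` over the prime ideals `𝔭 ∤ 3` of `ℤ[ω]`, i.e. over primes
`π ≡ 1 (mod 3)` (one in each associate class). -/
def primeProd (f : ℝ → ℝ) : ℝ :=
  ∏' π : {p : Eis // Prime p ∧ (3 : Eis) ∣ (p - 1)}, f (Nm π.1)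

/-- Product of `f(N(𝔭))` over the prime ideals `𝔭 ∤ 3` dividing `x` (a finite product). -/
def primeDivProd (f : ℝ → ℝ) (x : Eis) : ℝ :=
  ∏ᶠ π ∈ {p : Eis | Prime p ∧ (3 : Eis) ∣ (p - 1) ∧ p ∣ x}, f (Nm π)

/-- The Hecke `L`-series `∑_𝔫 χ_q(𝔫) N(𝔫)^{-s}` (convergent for `Re(s) > 1`). -/
def heckeSeries (χ : Eis → Eis → Eis) (q : Eis) (s : ℂ) : ℂ :=
  ∑' n : {x : Eis // Rep x}, ((χ q n.1 : Eis) : ℂ) * (Nm n.1 : ℂ) ^ (-s)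

/-- `L` is the (unique) entire continuation of the Hecke `L`-series of `χ_q`. -/
def IsHeckeL (χ : Eis → Eis → Eis) (q : Eis) (L : ℂ → ℂ) : Prop :=
  Differentiable ℂ L ∧ ∀ s : ℂ, 1 < s.re → L s = heckeSeries χ q s

/-- Membership in the family `F₃` of conductors of primitive cubic Hecke characters
congruent to `1 (mod 9)`. -/
def memF₃ (q : Eis) : Prop :=
  ∃ q₁ q₂ : Eis, (3 : Eis) ∣ (q₁ - 1) ∧ (3 : Eis) ∣ (q₂ - 1) ∧ Squarefree (q₁ * q₂) ∧
    NmN (q₁ * q₂ ^ 2) % 9 = 1 ∧ q = q₁ * q₂ ^ 2 ∧ (9 : Eis) ∣ (q - 1) ∧ q ≠ 1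

/-- `ψ_α(r, s) = ∑_{c ≡ 1 (3), (c, α) = 1} g₃(r, c) N(c)^{-s}`. -/
def ψa (χ : Eis → Eis → Eis) (α r : Eis) (s : ℂ) : ℂ :=
  ∑' c : {c : Eis // (3 : Eis) ∣ (c - 1) ∧ IsCoprime c α},
    g₃ χ r c.1 * (Nm c.1 : ℂ) ^ (-s)

/-- `ψ(r, s) = ∑_{c ≡ 1 (3)} g₃(r, c) N(c)^{-s}`. -/
def ψ₀ (χ : Eis → Eis → Eis) (r : Eis) (s : ℂ) : ℂ :=
  ∑' c : {c : Eis // (3 : Eis) ∣ (c - 1)}, g₃ χ r c.1 * (Nm c.1 : ℂ) ^ (-s)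

/-- `Δ_α(s) = ∏_{π ≡ 1 (3) prime, π ∣ α} (1 - N(π)^{2-3s})`. -/
def Δprod (α : Eis) (s : ℂ) : ℂ :=
  ∏ᶠ π ∈ {p : Eis | Prime p ∧ (3 : Eis) ∣ (p - 1) ∧ p ∣ α},
    (1 - (Nm π : ℂ) ^ ((2 : ℂ) - 3 * s))

/-- `Ψ` is the (unique) continuation of `ψ(r, ·)` to the strip `1 < Re(s) < 2`,
holomorphic away from `s = 4/3`. -/
def IsPsiContinuation (χ : Eis → Eis → Eis) (r : Eis) (Ψ : ℂ → ℂ) : Prop :=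
  (∀ s : ℂ, 1 < s.re → s.re < 2 → s ≠ 4/3 → DifferentiableAt ℂ Ψ s) ∧
  (∀ s : ℂ, 3/2 < s.re → s.re < 2 → Ψ s = ψ₀ χ r s)


lemma wc_eq : ωc = -1/2 + (Real.sqrt 3 / 2 : ℝ) * I := by
  unfold ωc
  have : (2 * Real.pi * I / 3 : ℂ) = ((2 * Real.pi / 3 : ℝ) : ℂ) * I := by push_cast; ring
  rw [this, Complex.exp_mul_I, ← Complex.ofReal_cos, ← Complex.ofReal_sin]
  have h : (2 * Real.pi / 3 : ℝ) = Real.pi - Real.pi / 3 := by ring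
  rw [h, Real.cos_pi_sub, Real.sin_pi_sub, Real.cos_pi_div_three, Real.sin_pi_div_three]
  push_cast; ring

lemma wc_re : ωc.re = -1/2 := by rw [wc_eq]; simp
lemma wc_im : ωc.im = Real.sqrt 3 / 2 := by rw [wc_eq]; simp

lemma wE_sq : ωE ^ 2 = -1 - ωE := by
  apply Subtype.ext
  show ωc ^ 2 = -1 - ωc
  have h3 : Real.sqrt 3 ^ 2 = 3 := Real.sq_sqrt (by norm_num)
  apply Complex.ext
  · simp [pow_two, wc_re, wc_im]; nlinarith
  · simp [pow_two, wc_re, wc_im]; ring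

lemma wE_cube : ωE ^ 3 = 1 := by
  linear_combination (ωE - 1) * wE_sq

/-- Coordinates. -/
def mk (a b : ℤ) : Eis := a + b * ωE

lemma exists_mk (x : Eis) : ∃ a b : ℤ, x = mk a b := by
  obtain ⟨x, hx⟩ := x
  unfold Eis at hx
  induction hx using Subring.closure_induction with
  | mem x hx => 
    rw [Set.mem_singleton_iff] at hx; subst hx
    exact ⟨0, 1, by apply Subtype.ext; simp [mk, ωE]⟩
  | zero => exact ⟨0, 0, by apply Subtype.ext; simp [mk]⟩
  | one => exact ⟨1, 0, by apply Subtype.ext; simp [mk]⟩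
  | add x y hx hy h1 h2 =>
    obtain ⟨a, b, h1⟩ := h1
    obtain ⟨c, d, h2⟩ := h2
    refine ⟨a + c, b + d, ?_⟩
    have : (⟨x + y, add_mem hx hy⟩ : Eis) = ⟨x, hx⟩ + ⟨y, hy⟩ := rfl
    refine this.trans ?_
    rw [show (⟨x, hx⟩ : Eis) = _ from h1, show (⟨y, hy⟩ : Eis) = _ from h2]
    simp only [mk]; push_cast; ring
  | neg x hx h1 =>
    obtain ⟨a, b, h1⟩ := h1
    refine ⟨-a, -b, ?_⟩
    have : (⟨-x, neg_mem hx⟩ : Eis) = -⟨x, hx⟩ := rfl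
    refine this.trans ?_
    rw [show (⟨x, hx⟩ : Eis) = _ from h1]
    simp only [mk]; push_cast; ring
  | mul x y hx hy h1 h2 =>
    obtain ⟨a, b, h1⟩ := h1
    obtain ⟨c, d, h2⟩ := h2
    refine ⟨a * c - b * d, a * d + b * c - b * d, ?_⟩
    have : (⟨x * y, mul_mem hx hy⟩ : Eis) = ⟨x, hx⟩ * ⟨y, hy⟩ := rfl
    refine this.trans ?_
    rw [show (⟨x, hx⟩ : Eis) = _ from h1, show (⟨y, hy⟩ : Eis) = _ from h2]
    simp only [mk]; push_cast
    linear_combination (b * d : Eis) * wE_sq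

lemma mk_coe (a b : ℤ) : ((mk a b : Eis) : ℂ) = a + b * ωc := by
  simp [mk, ωE]

lemma mk_re (a b : ℤ) : ((mk a b : Eis) : ℂ).re = a - b / 2 := by
  rw [mk_coe]; simp [wc_re]; ring
lemma mk_im (a b : ℤ) : ((mk a b : Eis) : ℂ).im = b * (Real.sqrt 3 / 2) := by
  rw [mk_coe]; simp [wc_im]

lemma mk_inj {a b c d : ℤ} (h : mk a b = mk c d) : a = c ∧ b = d := by
  have h1 := congrArg (fun z : Eis => (z : ℂ).im) h
  have h2 := congrArg (fun z : Eis => (z : ℂ).re) h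
  simp only [mk_re, mk_im] at h1 h2
  have h3 : Real.sqrt 3 / 2 ≠ 0 := by positivity
  have h4 := mul_right_cancel₀ h3 h1
  have h5 : (a : ℝ) = c := by rw [h4] at h2; linarith
  exact ⟨by exact_mod_cast h5, by exact_mod_cast h4⟩

lemma mk_mul (a b c d : ℤ) : mk a b * mk c d = mk (a * c - b * d) (a * d + b * c - b * d) := by
  simp only [mk]; push_cast
  linear_combination (b * d : Eis) * wE_sq
lemma mk_add (a b c d : ℤ) : mk a b + mk c d = mk (a + c) (b + d) := by
  simp only [mk]; push_cast; ring
lemma mk_sub (a b c d : ℤ) : mk a b - mk c d = mk (a - c) (b - d) := by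
  simp only [mk]; push_cast; ring
lemma int_eq_mk (n : ℤ) : (n : Eis) = mk n 0 := by simp [mk]

lemma Nm_mk (a b : ℤ) : Nm (mk a b) = ((a ^ 2 - a * b + b ^ 2 : ℤ) : ℝ) := by
  have h3 : Real.sqrt 3 ^ 2 = 3 := Real.sq_sqrt (by norm_num)
  rw [Nm, Complex.normSq_apply, mk_re, mk_im]
  push_cast
  linear_combination (b ^ 2 / 4 : ℝ) * h3

lemma Nm_mul (x y : Eis) : Nm (x * y) = Nm x * Nm y := by simp [Nm]
lemma Nm_nonneg (x : Eis) : 0 ≤ Nm x := Complex.normSq_nonneg _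
lemma Nm_eq_zero {x : Eis} : Nm x = 0 ↔ x = 0 := by simp [Nm]
lemma Nm_pos {x : Eis} (h : x ≠ 0) : 0 < Nm x :=
  lt_of_le_of_ne (Nm_nonneg x) (fun h' => h (Nm_eq_zero.1 h'.symm))
lemma Nm_one : Nm 1 = 1 := by simp [Nm]
lemma Nm_pow (x : Eis) (n : ℕ) : Nm (x ^ n) = Nm x ^ n := by simp [Nm]

lemma Nm_eq (x : Eis) : Nm x = NmN x := by
  obtain ⟨a, b, rfl⟩ := exists_mk x
  have h0 : (0 : ℤ) ≤ a ^ 2 - a * b + b ^ 2 := by nlinarith [sq_nonneg (a - b), sq_nonneg a, sq_nonneg b]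
  obtain ⟨n, hn⟩ := Int.eq_ofNat_of_zero_le h0
  rw [NmN, Nm_mk, hn]
  simp

lemma NmN_mul (x y : Eis) : NmN (x * y) = NmN x * NmN y := by
  have := Nm_mul x y
  rw [Nm_eq, Nm_eq, Nm_eq] at this; exact_mod_cast this
lemma NmN_eq_zero {x : Eis} : NmN x = 0 ↔ x = 0 := by
  rw [← Nm_eq_zero, Nm_eq]; norm_cast
lemma NmN_pos {x : Eis} (h : x ≠ 0) : 0 < NmN x := Nat.pos_of_ne_zero (fun h' => h (NmN_eq_zero.1 h'))
lemma NmN_mk (a b : ℤ) : (NmN (mk a b) : ℤ) = a ^ 2 - a * b + b ^ 2 := by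
  have := Nm_mk a b
  rw [Nm_eq] at this; exact_mod_cast this
lemma NmN_one : NmN 1 = 1 := by have := Nm_one; rw [Nm_eq] at this; exact_mod_cast this
lemma one_le_Nm {x : Eis} (h : x ≠ 0) : 1 ≤ Nm x := by
  rw [Nm_eq]; exact_mod_cast NmN_pos h

/-- conjugation -/
def cj (x : Eis) : Eis := mk ((exists_mk x).choose - (exists_mk x).choose_spec.choose) (-(exists_mk x).choose_spec.choose)

lemma cj_mk (a b : ℤ) : cj (mk a b) = mk (a - b) (-b) := by
  have h := (exists_mk (mk a b)).choose_spec.choose_spec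
  obtain ⟨h1, h2⟩ := mk_inj h
  exact congrArg₂ mk (congrArg₂ (fun x y : ℤ => x - y) h1.symm h2.symm) (congrArg (fun x : ℤ => -x) h2.symm)

lemma cj_coe (x : Eis) : ((cj x : Eis) : ℂ) = (starRingEnd ℂ) (x : ℂ) := by
  obtain ⟨a, b, rfl⟩ := exists_mk x
  rw [cj_mk]
  apply Complex.ext
  · rw [Complex.conj_re, mk_re, mk_re]; push_cast; ring
  · rw [Complex.conj_im, mk_im, mk_im]; push_cast; ring

lemma mul_cj (x : Eis) : x * cj x = (NmN x : Eis) := by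
  apply Subtype.ext
  have : ((NmN x : Eis) : ℂ) = (Nm x : ℝ) := by rw [Nm_eq]; simp
  rw [this, Subring.coe_mul, cj_coe, Complex.mul_conj]; rfl

lemma isUnit_iff {x : Eis} : IsUnit x ↔ NmN x = 1 := by
  constructor
  · rintro ⟨u, rfl⟩
    have : NmN (u : Eis) * NmN ((u⁻¹ : Eisˣ) : Eis) = 1 := by
      rw [← NmN_mul]; simp [NmN_one]
    exact Nat.eq_one_of_mul_eq_one_right this
  · intro h
    have := mul_cj x
    rw [h, Nat.cast_one] at this
    exact IsUnit.of_mul_eq_one _ this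

lemma exists_div (x y : Eis) (hy : y ≠ 0) : ∃ q : Eis, NmN (x - q * y) < NmN y := by
  obtain ⟨a, b, hab⟩ := exists_mk (x * cj y)
  set n := NmN y with hn
  have hn0 : 0 < n := NmN_pos hy
  have hn0' : (n : ℝ) ≠ 0 := by positivity
  refine ⟨mk (round (a / n : ℝ)) (round (b / n : ℝ)), ?_⟩
  set u := round (a / n : ℝ)
  set v := round (b / n : ℝ)
  have hu := abs_sub_round (a / n : ℝ)
  have hv := abs_sub_round (b / n : ℝ)
  have key : (x - mk u v * y) * cj y = mk (a - u * n) (b - v * n) := by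
    rw [sub_mul, hab, mul_assoc, mul_cj, ← hn]
    simp only [mk]; push_cast; ring
  have h1 : NmN (cj y) = n := by
    have h := congrArg NmN (mul_cj y)
    rw [NmN_mul, ← hn] at h
    have h2 : NmN (n : Eis) = n * n := by
      have := NmN_mk n 0
      rw [← int_eq_mk] at this
      push_cast at this
      have : (NmN (n : Eis) : ℤ) = n * n := by rw [this]; ring
      exact_mod_cast this
    rw [h2] at h
    exact Nat.eq_of_mul_eq_mul_left hn0 h
  have h2 := congrArg (fun z => (Nm z : ℝ)) key
  simp only [Nm_mul, Nm_mk] at h2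
  rw [Nm_eq (cj y), h1] at h2
  have h3 : (Nm (x - mk u v * y)) < n := by
    have e : Nm (x - mk u v * y) = n * (((a / n : ℝ) - u)^2 - ((a / n : ℝ) - u) * ((b / n : ℝ) - v) + ((b / n : ℝ) - v)^2) := by
      apply mul_right_cancel₀ hn0'
      rw [h2]; push_cast; field_simp
    rw [e]
    have hn1 : (0 : ℝ) < n := by positivity
    have : (((a / n : ℝ) - u)^2 - ((a / n : ℝ) - u) * ((b / n : ℝ) - v) + ((b / n : ℝ) - v)^2) < 1 := by
      rw [abs_le] at hu hv
      nlinarith [hu.1, hu.2, hv.1, hv.2]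
    nlinarith
  rw [Nm_eq] at h3
  exact_mod_cast h3

instance : IsPrincipalIdealRing Eis := by
  constructor
  intro I
  by_cases hI : I = ⊥
  · exact ⟨⟨0, by simp [hI]⟩⟩
  have hex : ∃ n, ∃ y ∈ I, y ≠ 0 ∧ NmN y = n := by
    obtain ⟨y, hy, hy0⟩ := Submodule.exists_mem_ne_zero_of_ne_bot hI
    exact ⟨_, y, hy, hy0, rfl⟩
  classical
  obtain ⟨y, hy, hy0, hyn⟩ := Nat.find_spec hex
  refine ⟨⟨y, le_antisymm ?_ ?_⟩⟩
  · intro x hx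
    obtain ⟨q, hq⟩ := exists_div x y hy0
    have hm : x - q * y ∈ I := I.sub_mem hx (I.mul_mem_left q hy)
    have : x - q * y = 0 := by
      by_contra h
      have := Nat.find_min hex (m := NmN (x - q * y)) (by omega)
      exact this ⟨_, hm, h, rfl⟩
    refine Submodule.mem_span_singleton.2 ⟨q, ?_⟩
    rw [smul_eq_mul]; exact (sub_eq_zero.1 this).symm
  · rw [Submodule.span_le]; simpa using hy

/-- primary elements -/
abbrev Pri (c : Eis) : Prop := (3 : Eis) ∣ (c - 1)

lemma pri_one : Pri 1 := by simp [Pri]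
lemma Pri.mul {a b : Eis} (ha : Pri a) (hb : Pri b) : Pri (a * b) := by
  have : a * b - 1 = (a - 1) * b + (b - 1) := by ring
  rw [Pri, this]; exact dvd_add (Dvd.dvd.mul_right ha _) hb
lemma Pri.pow {a : Eis} (ha : Pri a) (n : ℕ) : Pri (a ^ n) := by
  induction n with
  | zero => simpa using pri_one
  | succ n ih => rw [pow_succ]; exact ih.mul ha
lemma Pri.of_mul {a b : Eis} (ha : Pri a) (hb : Pri (a * b)) : Pri b := by
  have : b - 1 = (a * b - 1) - (a - 1) * b := by ring
  rw [Pri, this]; exact dvd_sub hb (Dvd.dvd.mul_right ha _)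

lemma three_eq : (3 : Eis) = mk 3 0 := by have := int_eq_mk 3; exact_mod_cast this
lemma one_eq : (1 : Eis) = mk 1 0 := by have := int_eq_mk 1; exact_mod_cast this
lemma lam_eq : lam = mk 1 2 := by simp [lam, mk]

lemma three_dvd_mk {a b : ℤ} : (3 : Eis) ∣ mk a b ↔ 3 ∣ a ∧ 3 ∣ b := by
  constructor
  · rintro ⟨x, hx⟩
    obtain ⟨c, d, rfl⟩ := exists_mk x
    rw [three_eq, mk_mul] at hx
    obtain ⟨h1, h2⟩ := mk_inj hx
    exact ⟨⟨c, by linarith⟩, ⟨d, by linarith⟩⟩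
  · rintro ⟨⟨c, rfl⟩, ⟨d, rfl⟩⟩
    exact ⟨mk c d, by simp only [mk]; push_cast; ring⟩

lemma pri_mk {a b : ℤ} : Pri (mk a b) ↔ 3 ∣ a - 1 ∧ 3 ∣ b := by
  rw [Pri, one_eq, mk_sub, three_dvd_mk, sub_zero]

lemma Pri.eq_one {u : Eis} (h : Pri u) (hu : IsUnit u) : u = 1 := by
  obtain ⟨a, b, rfl⟩ := exists_mk u
  rw [isUnit_iff] at hu
  have h1 := NmN_mk a b
  rw [hu] at h1
  rw [pri_mk] at h
  have hb : b = 0 := by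
    have : b ^ 2 < 2 ^ 2 := by push_cast at h1; nlinarith [sq_nonneg (2 * a - b)]
    have := abs_lt_of_sq_lt_sq this (by norm_num)
    rw [abs_lt] at this; omega
  subst hb
  have ha : a ^ 2 = 1 ^ 2 := by push_cast at h1; linarith
  rcases sq_eq_sq_iff_eq_or_eq_neg.1 ha with h' | h'
  · rw [h', one_eq]
  · omega

lemma lam_dvd_three : lam ∣ 3 := ⟨mk (-1) (-2), by rw [lam_eq, mk_mul, three_eq]; norm_num⟩

lemma lam_not_unit : ¬ IsUnit lam := by
  rw [isUnit_iff, lam_eq]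
  have := NmN_mk 1 2
  norm_num at this
  intro h; rw [h] at this; norm_num at this

lemma Pri.not_lam_dvd {c : Eis} (h : Pri c) : ¬ lam ∣ c := by
  intro h'
  apply lam_not_unit
  apply isUnit_of_dvd_one
  have : (1 : Eis) = c - (c - 1) := by ring
  rw [this]; exact dvd_sub h' (lam_dvd_three.trans h)

lemma Pri.ne_zero {c : Eis} (h : Pri c) : c ≠ 0 := by
  rintro rfl; exact h.not_lam_dvd (dvd_zero _)

lemma exists_unit_pri {x : Eis} (hx : ¬ lam ∣ x) : ∃ u : Eis, IsUnit u ∧ Pri (u * x) := by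
  obtain ⟨a, b, rfl⟩ := exists_mk x
  have hlam : ∀ c d : ℤ, lam * mk c d = mk (c - 2 * d) (2 * c - d) := by
    intro c d; rw [lam_eq, mk_mul]; congr 1 <;> ring
  have hu : ∀ c d : ℤ, c ^ 2 - c * d + d ^ 2 = 1 → IsUnit (mk c d) := by
    intro c d h; rw [isUnit_iff]; have := NmN_mk c d; rw [h] at this; exact_mod_cast this
  have key : ∀ c d : ℤ, c ^ 2 - c * d + d ^ 2 = 1 → (3 ∣ (c * a - d * b) - 1 ∧ 3 ∣ c * b + d * a - d * b) →
      ∃ u : Eis, IsUnit u ∧ Pri (u * mk a b) := by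
    intro c d h h'; exact ⟨mk c d, hu c d h, by rw [mk_mul, pri_mk]; exact h'⟩
  have h0 : ¬ 3 ∣ a + b := by
    rintro ⟨k, hk⟩
    apply hx
    refine ⟨mk (b - k) (b - 2 * k), ?_⟩
    rw [hlam]; congr 1 <;> linarith
  have ha : a % 3 = 0 ∨ a % 3 = 1 ∨ a % 3 = 2 := by omega
  have hb : b % 3 = 0 ∨ b % 3 = 1 ∨ b % 3 = 2 := by omega
  rcases ha with ha | ha | ha <;> rcases hb with hb | hb | hb <;> try omega
  · exact key (-1) (-1) (by norm_num) (by omega)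
  · exact key 1 1 (by norm_num) (by omega)
  · exact key 1 0 (by norm_num) (by omega)
  · exact key 0 (-1) (by norm_num) (by omega)
  · exact key (-1) 0 (by norm_num) (by omega)
  · exact key 0 1 (by norm_num) (by omega)

lemma Pri.exists_prime {c : Eis} (h : Pri c) (h1 : c ≠ 1) : ∃ π, Prime π ∧ Pri π ∧ π ∣ c := by
  have hu : ¬ IsUnit c := fun hu => h1 (h.eq_one hu)
  obtain ⟨p, hp, hpc⟩ := WfDvdMonoid.exists_irreducible_factor hu h.ne_zero
  obtain ⟨u, hu, hup⟩ := exists_unit_pri (x := p) (fun hl => h.not_lam_dvd (hl.trans hpc))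
  refine ⟨u * p, ?_, hup, ?_⟩
  · have : Associated p (u * p) := ⟨hu.unit, by rw [IsUnit.unit_spec, mul_comm]⟩
    exact this.prime hp.prime
  · exact (hu.mul_left_dvd).2 hpc

lemma prime_two_le {π : Eis} (hπ : Prime π) : 2 ≤ NmN π := by
  have h0 := NmN_pos hπ.ne_zero
  have h1 : NmN π ≠ 1 := fun h => hπ.not_isUnit (isUnit_iff.2 h)
  omega

lemma Pri.induction {P : Eis → Prop} (h1 : P 1)
    (hm : ∀ π c, Prime π → Pri π → Pri c → P c → P (π * c)) {c : Eis} (hc : Pri c) : P c := by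
  induction hn : NmN c using Nat.strong_induction_on generalizing c with
  | _ n ih =>
    by_cases h : c = 1
    · rw [h]; exact h1
    obtain ⟨π, hπ, hp, x, rfl⟩ := hc.exists_prime h
    have hx : Pri x := hp.of_mul hc
    refine hm π x hπ hp hx (ih (NmN x) ?_ hx rfl)
    rw [← hn, NmN_mul]
    have := prime_two_le hπ
    have := NmN_pos hx.ne_zero
    nlinarith

lemma prime_eq_of_dvd {π ρ : Eis} (hπ : Prime π) (hρ : Prime ρ) (h1 : Pri π) (h2 : Pri ρ) (h : π ∣ ρ) : π = ρ := by
  obtain ⟨u, rfl⟩ := h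
  have hu : IsUnit u := (hρ.irreducible.isUnit_or_isUnit rfl).resolve_left hπ.not_isUnit
  rw [(h1.of_mul h2).eq_one hu, mul_one]

lemma Pri.NmN_mod {c : Eis} (h : Pri c) : NmN c % 3 = 1 := by
  obtain ⟨a, b, rfl⟩ := exists_mk c
  rw [pri_mk] at h
  obtain ⟨⟨k, hk⟩, ⟨l, hl⟩⟩ := h
  have h1 := NmN_mk a b
  have ha : a = 3 * k + 1 := by linarith
  rw [ha, hl] at h1
  have : ((NmN (mk a b) : ℕ) : ℤ) = 3 * (3 * k ^ 2 + 2 * k - (3 * k + 1) * l + 3 * l ^ 2) + 1 := by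
    rw [ha, hl, h1]; ring
  omega

lemma Pri.isCoprime_three {c : Eis} (h : Pri c) : IsCoprime c 3 := by
  obtain ⟨k, hk⟩ := h
  exact ⟨1, -k, by linear_combination hk⟩

/-- linear equivalence -/
def coordEquiv : Eis ≃ₗ[ℤ] (Fin 2 → ℤ) := LinearEquiv.symm
  { toFun := fun v => mk (v 0) (v 1)
    map_add' := fun v w => by simp [mk]; ring
    map_smul' := fun n v => by simp [mk]; ring
    invFun := fun x => ![(exists_mk x).choose, (exists_mk x).choose_spec.choose]
    left_inv := fun v => by
      have h := (exists_mk (mk (v 0) (v 1))).choose_spec.choose_spec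
      obtain ⟨h1, h2⟩ := mk_inj h
      ext i; fin_cases i
      · exact h1.symm
      · exact h2.symm
    right_inv := fun x => ((exists_mk x).choose_spec.choose_spec).symm }

lemma coordEquiv_symm (v : Fin 2 → ℤ) : coordEquiv.symm v = mk (v 0) (v 1) := rfl
lemma coordEquiv_mk (a b : ℤ) : coordEquiv (mk a b) = ![a, b] := by
  rw [← LinearEquiv.eq_symm_apply, coordEquiv_symm]; simp

def eBasis : Module.Basis (Fin 2) ℤ Eis := Module.Basis.ofEquivFun coordEquiv

instance : Module.Free ℤ Eis := Module.Free.of_basis eBasis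
instance : Module.Finite ℤ Eis := Module.Finite.of_basis eBasis

lemma norm_mk (a b : ℤ) : Algebra.norm ℤ (mk a b) = a ^ 2 - a * b + b ^ 2 := by
  rw [Algebra.norm_eq_matrix_det eBasis, Matrix.det_fin_two]
  simp only [Algebra.leftMulMatrix_eq_repr_mul]
  have e0 : eBasis 0 = mk 1 0 := by simp [eBasis, Module.Basis.ofEquivFun, coordEquiv_symm]
  have e1 : eBasis 1 = mk 0 1 := by simp [eBasis, Module.Basis.ofEquivFun, coordEquiv_symm]
  have er : ∀ x i, eBasis.repr x i = coordEquiv x i := fun x i => rfl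
  simp only [e0, e1, mk_mul, er, coordEquiv_mk]
  simp; ring

lemma card_quot {c : Eis} : Nat.card (Eis ⧸ Ideal.span {c}) = NmN c := by
  have h := Ideal.absNorm_span_singleton c
  rw [Ideal.absNorm_apply, Submodule.cardQuot_apply] at h
  rw [h]
  obtain ⟨a, b, rfl⟩ := exists_mk c
  rw [norm_mk, ← NmN_mk]; simp

lemma finite_quot {c : Eis} (h : c ≠ 0) : Finite (Eis ⧸ Ideal.span {c}) := by
  apply Nat.finite_of_card_ne_zero
  rw [card_quot]; exact (NmN_pos h).ne'

/-! ### Sums modulo `c` -/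

/-- sum of `f` over residues modulo `c` -/
def SS (c : Eis) (f : Eis → ℂ) : ℂ := ∑ᶠ d : Eis ⧸ Ideal.span {c}, f d.out

/-- periodicity -/
def Per (c : Eis) (f : Eis → ℂ) : Prop := ∀ x y, c ∣ x - y → f x = f y

lemma q_eq {c x y : Eis} : (Ideal.Quotient.mk (Ideal.span {c}) x = Ideal.Quotient.mk (Ideal.span {c}) y) ↔ c ∣ x - y := by
  rw [Ideal.Quotient.eq, Ideal.mem_span_singleton]

lemma mk_out' {c : Eis} (d : Eis ⧸ Ideal.span {c}) : Ideal.Quotient.mk (Ideal.span {c}) d.out = d :=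
  Ideal.Quotient.mk_out d

lemma out_mk (c x : Eis) : c ∣ (Ideal.Quotient.mk (Ideal.span {c}) x).out - x := by
  rw [← q_eq, mk_out']

lemma SS_congr {c : Eis} {f g : Eis → ℂ} (h : ∀ x, f x = g x) : SS c f = SS c g := by
  unfold SS; exact finsum_congr (fun d => h _)

lemma SS_reindex {c : Eis} {f : Eis → ℂ} (hf : Per c f) (φ : Eis → Eis)
    (h1 : ∀ x y, c ∣ φ x - φ y ↔ c ∣ x - y) (h2 : ∀ z, ∃ x, c ∣ φ x - z) :
    SS c (fun x => f (φ x)) = SS c f := by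
  unfold SS
  refine finsum_eq_of_bijective (fun d => Ideal.Quotient.mk (Ideal.span {c}) (φ d.out)) ⟨?_, ?_⟩ ?_
  · intro d e h
    simp only at h
    rw [q_eq, h1, ← q_eq, mk_out', mk_out'] at h
    exact h
  · intro d
    obtain ⟨x, hx⟩ := h2 d.out
    refine ⟨Ideal.Quotient.mk _ x, ?_⟩
    simp only
    rw [← mk_out' d, q_eq]
    have : c ∣ φ (Ideal.Quotient.mk (Ideal.span {c}) x).out - φ x := by rw [h1]; exact out_mk c x
    convert dvd_add this hx using 1
    ring
  · intro d
    refine hf _ _ ?_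
    rw [← dvd_neg, neg_sub]
    exact out_mk c _

lemma SS_shift {c : Eis} {f : Eis → ℂ} (hf : Per c f) (t : Eis) :
    SS c (fun x => f (x + t)) = SS c f :=
  SS_reindex hf (fun x => x + t) (fun x y => by simp) (fun z => ⟨z - t, by simp⟩)

lemma SS_unit {c : Eis} {f : Eis → ℂ} (hf : Per c f) {u : Eis} (hu : IsCoprime c u) :
    SS c (fun x => f (u * x)) = SS c f := by
  refine SS_reindex hf (fun x => u * x) (fun x y => ?_) (fun z => ?_)
  · rw [← mul_sub]; exact ⟨fun h => IsCoprime.dvd_of_dvd_mul_left hu h, fun h => Dvd.dvd.mul_left h u⟩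
  · obtain ⟨a, b, h⟩ := hu
    exact ⟨b * z, -a * z, by linear_combination z * h⟩

lemma SS_mul_split {a b : Eis} (ha : a ≠ 0) (hb : b ≠ 0) {f : Eis → ℂ} (hf : Per (a * b) f) :
    SS (a * b) f = SS a (fun x => SS b (fun y => f (x + a * y))) := by
  have := finite_quot ha
  have := finite_quot hb
  have := finite_quot (mul_ne_zero ha hb)
  unfold SS
  have e : ∑ᶠ d : Eis ⧸ Ideal.span {a}, ∑ᶠ e : Eis ⧸ Ideal.span {b}, f (d.out + a * e.out)
      = ∑ᶠ p : (Eis ⧸ Ideal.span {a}) × (Eis ⧸ Ideal.span {b}), f (p.1.out + a * p.2.out) := by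
    have := Fintype.ofFinite (Eis ⧸ Ideal.span {a})
    have := Fintype.ofFinite (Eis ⧸ Ideal.span {b})
    simp only [finsum_eq_sum_of_fintype]
    rw [Fintype.sum_prod_type]
  rw [e]
  symm
  refine finsum_eq_of_bijective (fun p => Ideal.Quotient.mk (Ideal.span {a * b}) (p.1.out + a * p.2.out)) ⟨?_, ?_⟩ ?_
  · rintro ⟨d, e⟩ ⟨d', e'⟩ h
    simp only at h
    rw [q_eq] at h
    have h1 : a ∣ d.out - d'.out := by
      have := (dvd_mul_right a b).trans h
      have h2 : d.out - d'.out = (d.out + a * e.out - (d'.out + a * e'.out)) - a * (e.out - e'.out) := by ring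
      rw [h2]; exact dvd_sub this (dvd_mul_right _ _)
    rw [← q_eq, mk_out', mk_out'] at h1
    subst h1
    have h3 : d.out + a * e.out - (d.out + a * e'.out) = a * (e.out - e'.out) := by ring
    rw [h3, mul_dvd_mul_iff_left ha, ← q_eq, mk_out', mk_out'] at h
    subst h; rfl
  · intro z
    obtain ⟨t, ht⟩ := out_mk a z.out
    obtain ⟨w, hw⟩ := out_mk b (-t)
    refine ⟨(Ideal.Quotient.mk _ z.out, Ideal.Quotient.mk _ (-t)), ?_⟩
    simp only
    rw [← mk_out' z, q_eq]
    refine ⟨w, ?_⟩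
    simp only [mk_out'] at ht ⊢
    linear_combination ht + a * hw
  · rintro ⟨d, e⟩
    refine hf _ _ ?_
    rw [← dvd_neg, neg_sub]
    exact out_mk (a * b) _

lemma SS_const_mul (c : Eis) (k : ℂ) (f : Eis → ℂ) : SS c (fun x => k * f x) = k * SS c f := by
  unfold SS
  by_cases hk : k = 0
  · simp [hk]
  · simpa [smul_eq_mul] using (smul_finsum k (fun d : Eis ⧸ Ideal.span {c} => f d.out)).symm

lemma SS_const {c : Eis} (k : ℂ) : SS c (fun _ => k) = (Nm c : ℂ) * k := by
  unfold SS
  by_cases h : c = 0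
  · subst h
    have : Infinite (Eis ⧸ Ideal.span {(0 : Eis)}) := by
      by_contra hh
      rw [not_infinite_iff_finite] at hh
      have h2 := card_quot (c := 0)
      have := Nat.card_pos (α := Eis ⧸ Ideal.span {(0 : Eis)})
      rw [h2] at this
      exact absurd (NmN_eq_zero.2 rfl) this.ne'
    by_cases hk : k = 0
    · simp [hk]
    · rw [Nm_eq_zero.2 rfl, finsum_of_infinite_support]
      · simp
      · have : Function.support (fun _ : Eis ⧸ Ideal.span {(0 : Eis)} => k) = Set.univ := by
          ext; simp [hk]
        rw [this]; exact Set.infinite_univ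
  · have := finite_quot h
    have := Fintype.ofFinite (Eis ⧸ Ideal.span {c})
    rw [finsum_eq_sum_of_fintype, Finset.sum_const, Finset.card_univ, ← Nat.card_eq_fintype_card, card_quot, Nm_eq]
    simp

lemma SS_fiber {a b : Eis} (ha : a ≠ 0) (hb : b ≠ 0) {f : Eis → ℂ} (hf : Per a f) :
    SS (a * b) f = Nm b * SS a f := by
  rw [SS_mul_split ha hb (fun x y h => hf x y ((dvd_mul_right a b).trans h)), ← SS_const_mul]
  apply SS_congr
  intro x
  rw [← SS_const]
  exact SS_congr (fun y => hf _ _ (by simp))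

lemma SS_crt {a b : Eis} (ha : a ≠ 0) (hb : b ≠ 0) (hab : IsCoprime a b) {f : Eis → ℂ} (hf : Per (a * b) f) :
    SS (a * b) f = SS a (fun x => SS b (fun y => f (b * x + a * y))) := by
  rw [SS_mul_split ha hb hf]
  refine (SS_unit (c := a) (u := b) (f := fun x => SS b (fun y => f (x + a * y))) ?_ hab).symm
  rintro x y ⟨t, ht⟩
  simp only
  rw [← SS_shift (c := b) (f := fun z => f (y + a * z)) _ t]
  · apply SS_congr
    intro z
    congr 1
    linear_combination ht
  · rintro u v ⟨w, hw⟩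
    exact hf _ _ ⟨w, by linear_combination a * hw⟩

lemma SS_norm_le {c : Eis} (hc : c ≠ 0) {f : Eis → ℂ} (hf : ∀ x, ‖f x‖ ≤ 1) : ‖SS c f‖ ≤ Nm c := by
  have := finite_quot hc
  have := Fintype.ofFinite (Eis ⧸ Ideal.span {c})
  unfold SS
  rw [finsum_eq_sum_of_fintype]
  refine (norm_sum_le_of_le _ (fun x _ => hf _)).trans ?_
  rw [Finset.sum_const, Finset.card_univ, ← Nat.card_eq_fintype_card, card_quot, Nm_eq]
  simp

lemma SS_zero_of_shift {c : Eis} {f : Eis → ℂ} (hf : Per c f) (t : Eis) {k : ℂ} (hk : k ≠ 1)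
    (h : ∀ x, f (x + t) = k * f x) : SS c f = 0 := by
  have h1 := SS_shift hf t
  rw [SS_congr h, SS_const_mul] at h1
  have : (k - 1) * SS c f = 0 := by linear_combination h1
  exact (mul_eq_zero.1 this).resolve_left (sub_ne_zero.2 hk)

/-! ### The additive character -/

lemma eE_add (z w : ℂ) : eE (z + w) = eE z * eE w := by
  unfold eE; rw [← Complex.exp_add, map_add]; congr 1; ring

lemma eE_zero : eE 0 = 1 := by simp [eE]

lemma eE_eis (x : Eis) : eE (x : ℂ) = 1 := by
  obtain ⟨a, b, rfl⟩ := exists_mk x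
  unfold eE
  rw [Complex.add_conj, mk_re, Complex.exp_eq_one_iff]
  exact ⟨2 * a - b, by push_cast; ring⟩

lemma eE_norm (z : ℂ) : ‖eE z‖ = 1 := by
  unfold eE
  rw [Complex.add_conj]
  have : 2 * (Real.pi : ℂ) * I * ((2 * z.re : ℝ) : ℂ) = ((2 * Real.pi * (2 * z.re) : ℝ) : ℂ) * I := by push_cast; ring
  rw [this, Complex.norm_exp_ofReal_mul_I]

lemma eE_conj (z : ℂ) : (starRingEnd ℂ) (eE z) = eE (-z) := by
  unfold eE
  rw [← Complex.exp_conj]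
  congr 1
  simp only [map_mul, map_add, Complex.conj_conj, map_ofNat, Complex.conj_ofReal, Complex.conj_I, map_neg]
  ring

/-- if all values of the character are 1 then `c` divides `m` up to `λ` -/
lemma eE_trivial {c m : Eis} (hc : c ≠ 0) (h : ∀ t : Eis, eE (((m * t : Eis) : ℂ) / c) = 1) : c ∣ lam * m := by
  have hcc : (c : ℂ) ≠ 0 := by simpa using hc
  have key : ∀ t : Eis, ∃ n : ℤ, 2 * (((m * t : Eis) : ℂ) / c).re = n := by
    intro t
    have := h t
    unfold eE at this
    rw [Complex.add_conj, Complex.exp_eq_one_iff] at this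
    obtain ⟨n, hn⟩ := this
    refine ⟨n, ?_⟩
    have h2 : (2 * Real.pi * I : ℂ) ≠ 0 := by simp [Real.pi_ne_zero]
    have h3 : (2 * Real.pi * I : ℂ) * (((2 * (((m * t : Eis) : ℂ) / c).re : ℝ) : ℂ) - n) = 0 := by
      rw [mul_sub, hn]; ring
    have h4 := sub_eq_zero.1 ((mul_eq_zero.1 h3).resolve_left h2)
    exact_mod_cast h4
  obtain ⟨n, hn⟩ := key 1
  obtain ⟨k, hk⟩ := key ωE
  set z : ℂ := (m : ℂ) / c with hz
  have e1 : (((m * 1 : Eis) : ℂ) / c) = z := by simp [hz]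
  have e2 : (((m * ωE : Eis) : ℂ) / c) = z * ωc := by
    rw [Subring.coe_mul]; simp only [ωE, hz]; ring
  rw [e1] at hn
  rw [e2, Complex.mul_re, wc_re, wc_im] at hk
  have h3 : Real.sqrt 3 * Real.sqrt 3 = 3 := Real.mul_self_sqrt (by norm_num)
  refine ⟨mk (n + k) n, ?_⟩
  have hl : (lam : ℂ) * z = (mk (n + k) n : Eis) := by
    rw [lam_eq]
    apply Complex.ext
    · rw [Complex.mul_re, mk_re, mk_im, mk_re]; push_cast; linarith
    · rw [Complex.mul_im, mk_re, mk_im, mk_im]; push_cast; linear_combination (Real.sqrt 3 / 2) * hn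
  apply Subtype.ext
  rw [Subring.coe_mul, Subring.coe_mul, ← hl, hz]
  field_simp

/-- values of the cubic symbol -/
def VV (x : Eis) : Prop := x = 0 ∨ x = 1 ∨ x = ωE ∨ x = ωE ^ 2

lemma wE_mk : ωE = mk 0 1 := by simp [mk]
lemma wE2_mk : ωE ^ 2 = mk (-1) (-1) := by rw [wE_sq]; simp [mk]; ring
lemma zero_mk : (0 : Eis) = mk 0 0 := by simp [mk]

lemma VV_mul {x y : Eis} (hx : VV x) (hy : VV y) : VV (x * y) := by
  have h4 : ωE ^ 2 * ωE ^ 2 = ωE := by linear_combination ωE * wE_cube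
  have h3 : ωE * ωE ^ 2 = 1 := by linear_combination wE_cube
  have h3' : ωE ^ 2 * ωE = 1 := by linear_combination wE_cube
  have h2 : ωE * ωE = ωE ^ 2 := by ring
  rcases hx with rfl | rfl | rfl | rfl <;> rcases hy with rfl | rfl | rfl | rfl <;>
    simp [VV, h4, h3, h3', h2]

lemma VV_cube {x : Eis} (hx : VV x) (h0 : x ≠ 0) : x ^ 3 = 1 := by
  rcases hx with rfl | rfl | rfl | rfl
  · exact absurd rfl h0
  · simp
  · exact wE_cube
  · rw [← pow_mul, mul_comm, pow_mul, wE_cube, one_pow]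

lemma VV_norm {x : Eis} (hx : VV x) : ‖(x : ℂ)‖ ≤ 1 := by
  by_cases h0 : x = 0
  · simp [h0]
  · have h := VV_cube hx h0
    have h1 : ‖(x : ℂ)‖ ^ 3 = 1 := by
      rw [← norm_pow, ← Subring.coe_pow, h]; simp
    exact (pow_le_one_iff_of_nonneg (norm_nonneg _) (by norm_num : (3:ℕ) ≠ 0)).1 h1.le

lemma prime_four_le {π : Eis} (hπ : Prime π) (hp : Pri π) : 4 ≤ NmN π := by
  have := prime_two_le hπ
  have := hp.NmN_mod
  omega

lemma VV_eq {π x y : Eis} (hπ : Prime π) (hp : Pri π) (hx : VV x) (hy : VV y) (h : π ∣ x - y) : x = y := by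
  by_contra hne
  obtain ⟨z, hz⟩ := h
  have h4 := prime_four_le hπ hp
  have hz0 : z ≠ 0 := by
    rintro rfl; apply hne; rw [mul_zero] at hz; exact sub_eq_zero.1 hz
  have h1 : 4 ≤ NmN (x - y) := by
    rw [hz, NmN_mul]; have := NmN_pos hz0; nlinarith
  have h2 : (4 : ℤ) ≤ (NmN (x - y) : ℤ) := by exact_mod_cast h1
  rcases hx with rfl | rfl | rfl | rfl <;> rcases hy with rfl | rfl | rfl | rfl <;>
    first
    | exact hne rfl
    | (rw [wE2_mk, wE_mk, mk_sub, NmN_mk] at h2; norm_num at h2)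
    | (rw [wE2_mk, zero_mk, mk_sub, NmN_mk] at h2; norm_num at h2)
    | (rw [wE2_mk, one_eq, mk_sub, NmN_mk] at h2; norm_num at h2)
    | (rw [zero_mk, one_eq, mk_sub, NmN_mk] at h2; norm_num at h2)
    | (rw [zero_mk, wE_mk, mk_sub, NmN_mk] at h2; norm_num at h2)
    | (rw [one_eq, wE_mk, mk_sub, NmN_mk] at h2; norm_num at h2)

section
variable {χ : Eis → Eis → Eis}

lemma chi_VV (hχ : IsCubicSymbol χ) {c : Eis} (hc : Pri c) (a : Eis) : VV (χ c a) := by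
  refine Pri.induction (P := fun c => VV (χ c a)) ?_ ?_ hc
  · rw [hχ.one_bot]; exact Or.inr (Or.inl rfl)
  · intro π c hπ hp hc ih
    rw [hχ.mul_bot _ _ _ hp hc]
    exact VV_mul (hχ.prime_vals π a hπ hp) ih

lemma chi_per (hχ : IsCubicSymbol χ) {c : Eis} (hc : Pri c) {a b : Eis} (h : c ∣ a - b) : χ c a = χ c b := by
  revert h
  refine Pri.induction (P := fun c => c ∣ a - b → χ c a = χ c b) ?_ ?_ hc
  · intro _; rw [hχ.one_bot, hχ.one_bot]
  · intro π c hπ hp hc ih h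
    rw [hχ.mul_bot _ _ _ hp hc, hχ.mul_bot _ _ _ hp hc, ih ((dvd_mul_left c π).trans h)]
    congr 1
    refine VV_eq hπ hp (hχ.prime_vals π a hπ hp) (hχ.prime_vals π b hπ hp) ?_
    have h1 := hχ.prime_congr π a hπ hp
    have h2 := hχ.prime_congr π b hπ hp
    have h3 : π ∣ a ^ ((NmN π - 1) / 3) - b ^ ((NmN π - 1) / 3) :=
      ((dvd_mul_right π c).trans h).trans (sub_dvd_pow_sub_pow a b _)
    have := dvd_add (dvd_sub h2 h1) h3
    convert this using 1; ring

lemma chi_mul (hχ : IsCubicSymbol χ) {c : Eis} (hc : Pri c) (a b : Eis) : χ c (a * b) = χ c a * χ c b := by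
  refine Pri.induction (P := fun c => χ c (a * b) = χ c a * χ c b) ?_ ?_ hc
  · simp [hχ.one_bot]
  · intro π c hπ hp hc ih
    rw [hχ.mul_bot _ _ _ hp hc, hχ.mul_bot _ _ _ hp hc, hχ.mul_bot _ _ _ hp hc, ih]
    have : χ π (a * b) = χ π a * χ π b := by
      refine VV_eq hπ hp (hχ.prime_vals π _ hπ hp) (VV_mul (hχ.prime_vals π a hπ hp) (hχ.prime_vals π b hπ hp)) ?_
      obtain ⟨x, hx⟩ := hχ.prime_congr π a hπ hp
      obtain ⟨y, hy⟩ := hχ.prime_congr π b hπ hp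
      obtain ⟨z, hz⟩ := hχ.prime_congr π (a * b) hπ hp
      rw [mul_pow] at hz
      refine ⟨-z + b ^ ((NmN π - 1) / 3) * x + χ π a * y, ?_⟩
      linear_combination -hz + b ^ ((NmN π - 1) / 3) * hx + χ π a * hy
    rw [this]; ring

lemma chi_ne_zero (hχ : IsCubicSymbol χ) {c a : Eis} (hc : Pri c) (h : IsCoprime c a) : χ c a ≠ 0 := by
  revert h
  refine Pri.induction (P := fun c => IsCoprime c a → χ c a ≠ 0) ?_ ?_ hc
  · simp [hχ.one_bot]
  · intro π c hπ hp hc ih h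
    rw [hχ.mul_bot _ _ _ hp hc]
    refine mul_ne_zero ?_ (ih h.of_mul_left_right)
    rw [Ne, hχ.prime_eq_zero π a hπ hp]
    exact (hπ.coprime_iff_not_dvd).1 h.of_mul_left_left

lemma chi_cube (hχ : IsCubicSymbol χ) {c a : Eis} (hc : Pri c) (h : IsCoprime c a) : χ c a ^ 3 = 1 :=
  VV_cube (chi_VV hχ hc a) (chi_ne_zero hχ hc h)

lemma chi_one (hχ : IsCubicSymbol χ) {c : Eis} (hc : Pri c) : χ c 1 = 1 := by
  have h := chi_ne_zero hχ hc (isCoprime_one_right)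
  have h2 := chi_mul hχ hc 1 1
  rw [mul_one] at h2
  exact (mul_eq_left₀ h).1 h2.symm

lemma chi_neg_one (hχ : IsCubicSymbol χ) {c : Eis} (hc : Pri c) : χ c (-1) = 1 := by
  have h : IsCoprime c (-1) := (isCoprime_one_right (x := c)).neg_right
  have h3 := chi_cube hχ hc h
  have h2 := chi_mul hχ hc (-1) (-1)
  rw [neg_mul_neg, one_mul, chi_one hχ hc] at h2
  linear_combination h3 + χ c (-1) * h2

lemma chi_neg (hχ : IsCubicSymbol χ) {c : Eis} (hc : Pri c) (a : Eis) : χ c (-a) = χ c a := by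
  rw [neg_eq_neg_one_mul, chi_mul hχ hc, chi_neg_one hχ hc, one_mul]

lemma chi_pow_bot (hχ : IsCubicSymbol χ) {c : Eis} (hc : Pri c) (k : ℕ) (a : Eis) : χ (c ^ k) a = χ c a ^ k := by
  induction k with
  | zero => simp [hχ.one_bot]
  | succ k ih => rw [pow_succ, hχ.mul_bot _ _ _ (hc.pow k) hc, ih, pow_succ]

lemma chi_pow (hχ : IsCubicSymbol χ) {c : Eis} (hc : Pri c) (k : ℕ) (a : Eis) : χ c (a ^ k) = χ c a ^ k := by
  induction k with
  | zero => simp [chi_one hχ hc]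
  | succ k ih => rw [pow_succ, chi_mul hχ hc, ih, pow_succ]

end

/-! ### residue fields -/

/-- the residue field -/
abbrev KF (π : Eis) := Eis ⧸ Ideal.span {π}

lemma KF_field {π : Eis} (hπ : Prime π) : IsField (KF π) := by
  have : (Ideal.span {π}).IsMaximal := PrincipalIdealRing.isMaximal_of_irreducible hπ.irreducible
  exact (Ideal.Quotient.maximal_ideal_iff_isField_quotient _).1 this

/-- field structure -/
@[reducible] def KFfield {π : Eis} (hπ : Prime π) : Field (KF π) :=
  have : (Ideal.span {π}).IsMaximal := PrincipalIdealRing.isMaximal_of_irreducible hπ.irreducible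
  Ideal.Quotient.field _

/-- the multiplicative character on the residue field -/
def mchar {χ : Eis → Eis → Eis} (hχ : IsCubicSymbol χ) {π : Eis} (hπ : Prime π) (hp : Pri π) :
    MulChar (KF π) Eis where
  toFun d := χ π d.out
  map_one' := by
    rw [← chi_one hχ hp]
    exact chi_per hχ hp (out_mk π 1)
  map_mul' x y := by
    rw [← chi_mul hχ hp]
    refine chi_per hχ hp ?_
    rw [← q_eq, mk_out', map_mul, mk_out', mk_out']
  map_nonunit' x hx := by
    rw [hχ.prime_eq_zero π _ hπ hp]
    by_contra h
    apply hx
    let _ := KFfield hπ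
    rw [isUnit_iff_ne_zero]
    rintro rfl
    apply h
    have := out_mk π 0
    simpa using this

section
variable {χ : Eis → Eis → Eis} (hχ : IsCubicSymbol χ) {π : Eis} (hπ : Prime π) (hp : Pri π)

lemma mchar_mk (a : Eis) : mchar hχ hπ hp (Ideal.Quotient.mk _ a) = χ π a :=
  chi_per hχ hp (out_mk π a)

lemma mchar_out (d : KF π) : mchar hχ hπ hp d = χ π d.out := rfl

lemma mchar_cube : mchar hχ hπ hp ^ 3 = 1 := by
  apply MulChar.ext
  intro a
  rw [MulChar.pow_apply_coe, MulChar.one_apply_coe, mchar_out]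
  apply VV_cube (hχ.prime_vals _ _ hπ hp)
  have := a.isUnit.map (mchar hχ hπ hp)
  rw [mchar_out] at this
  exact this.ne_zero

lemma mchar_congr (d : KF π) : Ideal.Quotient.mk (Ideal.span {π}) (mchar hχ hπ hp d) = d ^ ((NmN π - 1) / 3) := by
  have := hχ.prime_congr π d.out hπ hp
  rw [← q_eq, map_pow, mk_out'] at this
  exact this.symm

lemma exists_chi_ne_one {χ : Eis → Eis → Eis} (hχ : IsCubicSymbol χ) {π : Eis} (hπ : Prime π) (hp : Pri π) : ∃ a, ¬ π ∣ a ∧ χ π a ≠ 1 := by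
  by_contra! h
  let _ := KFfield hπ
  have := finite_quot hπ.ne_zero
  have := Fintype.ofFinite (KF π)
  have h4 := prime_four_le hπ hp
  have hm := hp.NmN_mod
  have hcard : Fintype.card (KF π) = NmN π := by rw [← Nat.card_eq_fintype_card, card_quot]
  set k := (NmN π - 1) / 3 with hk
  have hk0 : 0 < k := by omega
  have hall : ∀ d : KF π, d ≠ 0 → d ^ k = 1 := by
    intro d hd
    rw [← mchar_congr hχ hπ hp, mchar_out, h, map_one]
    intro hdv
    apply hd
    rw [← mk_out' d, Ideal.Quotient.eq_zero_iff_mem, Ideal.mem_span_singleton]; exact hdv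
  classical
  have hc : (Finset.univ.erase (0 : KF π)).card ≤ k := by
    have hsub : Finset.univ.erase (0 : KF π) ⊆ (Polynomial.nthRoots k (1 : KF π)).toFinset := by
      intro d hd
      rw [Multiset.mem_toFinset, Polynomial.mem_nthRoots hk0]
      exact hall d (Finset.ne_of_mem_erase hd)
    exact (Finset.card_le_card hsub).trans ((Multiset.toFinset_card_le _).trans (Polynomial.card_nthRoots k 1))
  rw [Finset.card_erase_of_mem (Finset.mem_univ _), Finset.card_univ, hcard] at hc
  omega

lemma mchar_ne_one : mchar hχ hπ hp ≠ 1 := by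
  obtain ⟨a, h1, h2⟩ := exists_chi_ne_one hχ hπ hp
  intro h
  apply h2
  rw [← mchar_mk hχ hπ hp, h]
  let _ := KFfield hπ
  apply MulChar.one_apply
  rw [isUnit_iff_ne_zero, Ne, Ideal.Quotient.eq_zero_iff_mem, Ideal.mem_span_singleton]
  exact h1

lemma mchar_sq_ne_one : mchar hχ hπ hp ^ 2 ≠ 1 := by
  intro h
  apply mchar_ne_one hχ hπ hp
  have h3 := mchar_cube hχ hπ hp
  rw [pow_succ, h, one_mul] at h3
  exact h3

lemma mchar_neg_one : mchar hχ hπ hp (-1) = 1 := by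
  have : (-1 : KF π) = Ideal.Quotient.mk _ (-1) := by simp
  rw [this, mchar_mk, chi_neg_one hχ hp]

end

lemma wE_prim : IsPrimitiveRoot ωE 3 := by
  refine IsPrimitiveRoot.iff_def _ _ |>.2 ⟨wE_cube, ?_⟩
  intro l hl
  have hne : ωE ≠ 1 := by
    rw [wE_mk, one_eq]; intro h; have := mk_inj h; omega
  have hne2 : ωE ^ 2 ≠ 1 := by
    rw [wE2_mk, one_eq]; intro h; have := mk_inj h; omega
  have h3 : l = 3 * (l / 3) + l % 3 := by omega
  rw [h3, pow_add, pow_mul, wE_cube, one_pow, one_mul] at hl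
  have : l % 3 = 0 ∨ l % 3 = 1 ∨ l % 3 = 2 := by omega
  rcases this with h | h | h
  · omega
  · rw [h, pow_one] at hl; exact absurd hl hne
  · rw [h] at hl; exact absurd hl hne2

section
variable {χ : Eis → Eis → Eis} (hχ : IsCubicSymbol χ) {π : Eis} (hπ : Prime π) (hp : Pri π)

lemma card_KF [Fintype (KF π)] : Fintype.card (KF π) = NmN π := by
  rw [← Nat.card_eq_fintype_card, card_quot]

lemma jacobi_pri [Fintype (KF π)] : Pri (-(jacobiSum (mchar hχ hπ hp) (mchar hχ hπ hp))) := by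
  let _ := KFfield hπ
  have hm := hp.NmN_mod
  obtain ⟨z, _, hz⟩ := exists_jacobiSum_eq_neg_one_add (F := KF π) (n := 3) (by norm_num) (mchar_cube hχ hπ hp)
    (mchar_cube hχ hπ hp) (by rw [card_KF]; omega) wE_prim
  refine ⟨z * ωE, ?_⟩
  refine (congrArg (fun x => -x - 1) hz).trans ?_
  linear_combination -z * wE_sq

lemma jacobi_dvd [Fintype (KF π)] : π ∣ jacobiSum (mchar hχ hπ hp) (mchar hχ hπ hp) := by
  let _ := KFfield hπ
  rw [← Ideal.mem_span_singleton, ← Ideal.Quotient.eq_zero_iff_mem]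
  rw [jacobiSum, map_sum]
  have hm := hp.NmN_mod
  have h4 := prime_four_le hπ hp
  set k := (NmN π - 1) / 3 with hk
  have h1 : ∀ x : KF π, Ideal.Quotient.mk (Ideal.span {π}) (mchar hχ hπ hp x * mchar hχ hπ hp (1 - x)) =
      ∑ j ∈ Finset.range (k + 1), (((-1) ^ j * (k.choose j : KF π)) * x ^ (k + j)) := by
    intro x
    rw [map_mul, mchar_congr, mchar_congr, ← hk, sub_eq_neg_add, add_pow, Finset.mul_sum]
    refine Finset.sum_congr rfl (fun j _ => ?_)
    rw [neg_pow, one_pow, pow_add]; ring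
  rw [Finset.sum_congr rfl (fun x _ => h1 x), Finset.sum_comm]
  refine Finset.sum_eq_zero (fun j hj => ?_)
  rw [← Finset.mul_sum]
  have := FiniteField.sum_pow_lt_card_sub_one (KF π) (k + j) (by
    have := Finset.mem_range.1 hj
    rw [card_KF]; omega)
  rw [this, mul_zero]

lemma jacobi_norm [Fintype (KF π)] : NmN (jacobiSum (mchar hχ hπ hp) (mchar hχ hπ hp)) = NmN π := by
  let _ := KFfield hπ
  set ch := mchar hχ hπ hp with hch
  have hinj : Function.Injective (Subring.subtype Eis) := Subtype.val_injective
  set cc := ch.ringHomComp (Subring.subtype Eis) with hcc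
  have h1 : cc ≠ 1 := (MulChar.ringHomComp_ne_one_iff hinj).2 (mchar_ne_one hχ hπ hp)
  have h2 : cc * cc ≠ 1 := by
    rw [hcc, ← MulChar.ringHomComp_mul, ← pow_two]
    exact (MulChar.ringHomComp_ne_one_iff hinj).2 (mchar_sq_ne_one hχ hπ hp)
  have hc : ringChar ℂ ≠ ringChar (KF π) := by
    rw [ringChar.eq_zero]
    exact (CharP.char_ne_zero_of_finite (KF π) _).symm
  have h3 := jacobiSum_mul_jacobiSum_inv hc h1 h1 h2
  have h4 : jacobiSum cc⁻¹ cc⁻¹ = (starRingEnd ℂ) (jacobiSum cc cc) := by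
    rw [jacobiSum, jacobiSum, map_sum]
    refine Finset.sum_congr rfl (fun x _ => ?_)
    rw [map_mul, ← MulChar.star_apply', ← MulChar.star_apply']; rfl
  rw [h4, Complex.mul_conj, card_KF] at h3
  rw [hcc, jacobiSum_ringHomComp] at h3
  have h5 : Nm (jacobiSum ch ch) = NmN π := by exact_mod_cast h3
  rw [Nm_eq] at h5
  exact_mod_cast h5

lemma jacobi_eq [Fintype (KF π)] : jacobiSum (mchar hχ hπ hp) (mchar hχ hπ hp) = -π := by
  have h1 := jacobi_pri hχ hπ hp
  obtain ⟨u, hu⟩ := jacobi_dvd hχ hπ hp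
  have h3 := jacobi_norm hχ hπ hp
  rw [hu, NmN_mul] at h3
  have h4 : NmN u = 1 := by
    have := NmN_pos hπ.ne_zero
    exact Nat.eq_of_mul_eq_mul_left this (by rw [h3, mul_one])
  have h5 : Pri (-u) := by
    apply hp.of_mul
    rw [hu] at h1
    convert h1 using 2; ring
  have h6 := h5.eq_one ((isUnit_iff.2 h4).neg)
  rw [hu]
  linear_combination -π * h6

end

lemma gauss_pow_frob {F K : Type*} [Field F] [Fintype F] [Field K] (l : ℕ) [Fact l.Prime] [CharP K l]
    (φ : MulChar F K) (ψ : AddChar F K) (k : ℕ) :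
    gaussSum φ ψ ^ (l ^ k) = gaussSum (φ ^ (l ^ k)) (ψ ^ (l ^ k)) := by
  induction k with
  | zero => simp
  | succ k ih =>
    rw [pow_succ, pow_mul, ih, gaussSum_frob, pow_mul, pow_mul]

lemma gauss_recip {F K : Type*} [Field F] [Fintype F] [Field K] (l : ℕ) [Fact l.Prime] [CharP K l]
    (φ : MulChar F K) (ψ : AddChar F K) (hψ : ψ.IsPrimitive) (h3 : φ ^ 3 = 1) (h1 : φ ≠ 1)
    (hneg : φ (-1) = 1) (k : ℕ) (hk : l ^ k % 3 = 1) (hl : ((l ^ k : ℕ) : F) ≠ 0)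
    (hcard : (Fintype.card F : K) ≠ 0) :
    φ ((l ^ k : ℕ) : F) * (Fintype.card F * jacobiSum φ φ) ^ ((l ^ k - 1) / 3) = 1 := by
  have ho : orderOf φ = 3 := by
    have : Fact (Nat.Prime 3) := ⟨by norm_num⟩
    exact orderOf_eq_prime h3 h1
  have hG3 : gaussSum φ ψ ^ 3 = Fintype.card F * jacobiSum φ φ := by
    have := gaussSum_pow_eq_prod_jacobiSum (χ := φ) (by omega) hψ
    rw [ho, hneg] at this
    simpa using this
  have hG0 := gaussSum_ne_zero_of_nontrivial hcard h1 hψ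
  have hf := gauss_pow_frob l φ ψ k
  set Q := l ^ k with hQ
  have hQ3 : Q = 3 * ((Q - 1) / 3) + 1 := by omega
  have hφQ : φ ^ Q = φ := by
    conv_lhs => rw [hQ3, pow_succ, pow_mul, h3, one_pow, one_mul]
  have hψQ : ψ ^ Q = AddChar.mulShift ψ (Q : F) := by
    rw [AddChar.pow_mulShift]
  rw [hφQ, hψQ] at hf
  have hs := gaussSum_mulShift φ ψ (Units.mk0 (Q : F) hl)
  rw [Units.val_mk0, ← hf] at hs
  rw [← hG3, ← pow_mul]
  apply mul_right_cancel₀ hG0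
  rw [mul_assoc, ← pow_succ, ← hQ3, hs, one_mul]

section
variable {χ : Eis → Eis → Eis} (hχ : IsCubicSymbol χ)

lemma recip_half (hχ : IsCubicSymbol χ) {π ρ : Eis} (hπ : Prime π) (hp : Pri π) (hρ : Prime ρ) (hr : Pri ρ)
    (hch : ringChar (KF ρ) ≠ ringChar (KF π)) :
    χ π (NmN ρ) * χ ρ (NmN π * π) = 1 := by
  let _ := KFfield hπ
  let _ := KFfield hρ
  have := finite_quot hπ.ne_zero
  have := finite_quot hρ.ne_zero
  have := Fintype.ofFinite (KF π)
  have := Fintype.ofFinite (KF ρ)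
  have hlp : Fact (ringChar (KF ρ)).Prime := ⟨CharP.char_is_prime (KF ρ) _⟩
  have hpp : Fact (ringChar (KF π)).Prime := ⟨CharP.char_is_prime (KF π) _⟩
  let P := AddChar.FiniteField.primitiveChar (KF π) (KF ρ) hch
  let K := CyclotomicField P.n (KF ρ)
  let f0 : Eis →+* KF ρ := Ideal.Quotient.mk (Ideal.span {ρ})
  let f1 : KF ρ →+* K := algebraMap (KF ρ) K
  have hf1 : Function.Injective f1 := f1.injective
  let f : Eis →+* K := f1.comp f0
  have hf : ∀ x y, VV x → VV y → f x = f y → x = y := by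
    intro x y hx hy h
    exact VV_eq hρ hr hx hy (q_eq.1 (hf1 h))
  have : CharP K (ringChar (KF ρ)) := charP_of_injective_algebraMap hf1 _
  let φ := (mchar hχ hπ hp).ringHomComp f
  have hφ1 : φ ≠ 1 := by
    intro h
    obtain ⟨a, ha, ha1⟩ := exists_chi_ne_one hχ hπ hp
    apply ha1
    apply hf _ _ (chi_VV hχ hp a) (Or.inr (Or.inl rfl))
    have h2 := congrArg (fun c : MulChar (KF π) K => c (Ideal.Quotient.mk _ a)) h
    have hu : IsUnit (Ideal.Quotient.mk (Ideal.span {π}) a) := by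
      rw [isUnit_iff_ne_zero, Ne, Ideal.Quotient.eq_zero_iff_mem, Ideal.mem_span_singleton]
      exact ha
    rw [MulChar.one_apply hu] at h2
    rw [map_one, ← h2]
    show _ = f _
    rw [mchar_mk]
  have hφ3 : φ ^ 3 = 1 := by
    show ((mchar hχ hπ hp).ringHomComp f) ^ 3 = 1
    rw [MulChar.ringHomComp_pow, mchar_cube, MulChar.ringHomComp_one]
  have hneg : φ (-1) = 1 := by
    show f (mchar hχ hπ hp (-1)) = 1
    rw [mchar_neg_one, map_one]
  obtain ⟨k, hk0, hk⟩ := FiniteField.card (KF ρ) (ringChar (KF ρ))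
  obtain ⟨j, hj0, hj⟩ := FiniteField.card (KF π) (ringChar (KF π))
  rw [card_KF] at hk hj
  have hQ : ((NmN ρ : ℕ) : KF π) ≠ 0 := by
    rw [hk]
    intro h
    rw [CharP.cast_eq_zero_iff (KF π) (ringChar (KF π))] at h
    exact hch ((Nat.prime_dvd_prime_iff_eq hpp.1 hlp.1).1 (hpp.1.dvd_of_dvd_pow h)).symm
  have hq : ((NmN π : ℕ) : K) ≠ 0 := by
    rw [hj]
    intro h
    rw [CharP.cast_eq_zero_iff K (ringChar (KF ρ))] at h
    exact hch ((Nat.prime_dvd_prime_iff_eq hlp.1 hpp.1).1 (hlp.1.dvd_of_dvd_pow h))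
  have key := gauss_recip (ringChar (KF ρ)) φ P.char P.prim hφ3 hφ1 hneg k (by rw [← hk]; exact hr.NmN_mod)
    (by rw [← hk]; exact hQ) (by rw [card_KF]; exact hq)
  rw [← hk, card_KF, jacobiSum_ringHomComp, jacobi_eq] at key
  have e1 : φ ((NmN ρ : ℕ) : KF π) = f (χ π (NmN ρ)) := by
    show f (mchar hχ hπ hp _) = _
    rw [← mchar_mk hχ hπ hp]; simp
  have e2 : ((NmN π : K) * f (-π)) ^ ((NmN ρ - 1) / 3) = f (χ ρ (-(NmN π * π))) := by
    have : (NmN π : K) * f (-π) = f (-(NmN π * π)) := by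
      rw [map_neg, map_neg, map_mul, map_natCast]; ring
    rw [this, ← map_pow]
    show f1 _ = f1 _
    congr 1
    rw [q_eq]
    exact hχ.prime_congr _ _ hρ hr
  rw [e1, e2, ← map_mul, ← map_one f] at key
  have := hf _ _ (VV_mul (chi_VV hχ hp _) (chi_VV hχ hr _)) (Or.inr (Or.inl rfl)) key
  rwa [chi_neg hχ hr] at this


lemma prime_coprime {π c : Eis} (hπ : Prime π) (h : ¬ π ∣ c) : IsCoprime π c :=
  (Irreducible.coprime_iff_not_dvd hπ.irreducible).2 h

lemma recip_prime_ne (hχ : IsCubicSymbol χ) {π ρ : Eis} (hπ : Prime π) (hp : Pri π) (hρ : Prime ρ) (hr : Pri ρ)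
    (hch : ringChar (KF ρ) ≠ ringChar (KF π)) :
    χ π ρ = χ ρ π := by
  have h1 := recip_half hχ hπ hp hρ hr hch
  have h2 := recip_half hχ hρ hr hπ hp hch.symm
  rw [chi_mul hχ hr] at h1
  rw [chi_mul hχ hp] at h2
  have h3 : χ π (NmN ρ) * χ ρ (NmN π) ≠ 0 := by
    intro h
    apply one_ne_zero (α := Eis)
    rw [← h1, ← mul_assoc, h, zero_mul]
  apply mul_left_cancel₀ h3
  linear_combination h2 - h1

lemma ringChar_dvd {π : Eis} : π ∣ ((ringChar (KF π) : ℕ) : Eis) := by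
  rw [← Ideal.mem_span_singleton, ← Ideal.Quotient.eq_zero_iff_mem, map_natCast]
  exact CharP.cast_eq_zero (KF π) _

lemma recip_of_primes (hχ : IsCubicSymbol χ) {a c : Eis} (ha : Pri a) (hc : Pri c)
    (h : ∀ τ, Prime τ → Pri τ → τ ∣ c → χ a τ = χ τ a) : χ a c = χ c a := by
  revert h
  refine Pri.induction (P := fun c => (∀ τ, Prime τ → Pri τ → τ ∣ c → χ a τ = χ τ a) → χ a c = χ c a) ?_ ?_ hc
  · intro _; rw [chi_one hχ ha, hχ.one_bot]
  · intro π c hπ hp hc ih h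
    rw [chi_mul hχ ha, hχ.mul_bot _ _ _ hp hc, h π hπ hp (dvd_mul_right _ _),
      ih (fun τ h1 h2 h3 => h τ h1 h2 (h3.mul_left _))]

lemma recip_prime (hχ : IsCubicSymbol χ) {π ρ : Eis} (hπ : Prime π) (hp : Pri π) (hρ : Prime ρ) (hr : Pri ρ)
    (hne : π ≠ ρ) : χ π ρ = χ ρ π := by
  by_cases hch : ringChar (KF ρ) = ringChar (KF π)
  swap
  · exact recip_prime_ne hχ hπ hp hρ hr hch
  let _ := KFfield hπ
  let _ := KFfield hρ
  have := finite_quot hπ.ne_zero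
  have := finite_quot hρ.ne_zero
  have := Fintype.ofFinite (KF π)
  have := Fintype.ofFinite (KF ρ)
  obtain ⟨k, hk0, hk⟩ := FiniteField.card (KF ρ) (ringChar (KF ρ))
  obtain ⟨j, hj0, hj⟩ := FiniteField.card (KF π) (ringChar (KF π))
  rw [card_KF] at hk hj
  have hπρ : ¬ π ∣ ρ := fun h => hne (prime_eq_of_dvd hπ hρ hp hr h)
  have hρπ : ¬ ρ ∣ π := fun h => hne (prime_eq_of_dvd hρ hπ hr hp h).symm
  have hcop : IsCoprime π ρ := prime_coprime hπ hπρ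
  have hd1 : π ∣ ((ringChar (KF π) : ℕ) : Eis) := ringChar_dvd
  have hd2 : ρ ∣ ((ringChar (KF ρ) : ℕ) : Eis) := ringChar_dvd
  rw [hch] at hd2
  rw [hch] at hk
  obtain ⟨x, hx⟩ := hcop.mul_dvd hd1 hd2
  set p := ringChar (KF π) with hpdef
  have hpp : 2 ≤ p := by
    have : Fact p.Prime := ⟨CharP.char_is_prime (KF π) _⟩
    exact this.1.two_le
  have hNp : NmN ((p : ℕ) : Eis) = p ^ 2 := by
    have : ((p : ℕ) : Eis) = mk p 0 := by
      have := int_eq_mk p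
      simpa using this
    have h2 : (NmN ((p : ℕ) : Eis) : ℤ) = p ^ 2 := by
      rw [this, NmN_mk]; ring
    exact_mod_cast h2
  have hxu : IsUnit x := by
    rw [isUnit_iff]
    have h1 := hNp
    rw [hx, NmN_mul, NmN_mul, hk, hj] at h1
    have ej : p ^ (j : ℕ) = p * p ^ ((j : ℕ) - 1) := by
      rw [← pow_succ']; congr 1; have := j.pos; omega
    have ek : p ^ (k : ℕ) = p * p ^ ((k : ℕ) - 1) := by
      rw [← pow_succ']; congr 1; have := k.pos; omega
    rw [ej, ek] at h1
    have h2 : p ^ 2 * (p ^ ((j : ℕ) - 1) * p ^ ((k : ℕ) - 1) * NmN x) = p ^ 2 * 1 := by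
      rw [mul_one]; refine Eq.trans ?_ h1; ring
    have h3 := Nat.eq_of_mul_eq_mul_left (by positivity) h2
    exact (mul_eq_one.1 h3).2
  have ht : Pri (-(π + ρ)) := by
    obtain ⟨u, hu⟩ := hp
    obtain ⟨v, hv⟩ := hr
    exact ⟨-u - v - 1, by linear_combination -hu - hv⟩
  have hfac : ∀ τ, Prime τ → Pri τ → τ ∣ -(π + ρ) → ringChar (KF τ) ≠ p := by
    intro τ hτ hτp hd h
    have h1 : τ ∣ ((ringChar (KF τ) : ℕ) : Eis) := ringChar_dvd
    rw [h, hx] at h1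
    rw [dvd_neg] at hd
    rcases hτ.dvd_or_dvd h1 with h1 | h1
    · rcases hτ.dvd_or_dvd h1 with h1 | h1
      · have e1 := prime_eq_of_dvd hτ hπ hτp hp h1
        have e2 := prime_eq_of_dvd hτ hρ hτp hr ((dvd_add_right h1).1 hd)
        exact hne (e1.symm.trans e2)
      · have e1 := prime_eq_of_dvd hτ hπ hτp hp ((dvd_add_left h1).1 hd)
        have e2 := prime_eq_of_dvd hτ hρ hτp hr h1
        exact hne (e1.symm.trans e2)
    · exact hτ.not_isUnit (isUnit_of_dvd_unit h1 hxu)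
  calc χ π ρ = χ π (π + ρ) := chi_per hχ hp ⟨-1, by ring⟩
    _ = χ π (-(π + ρ)) := (chi_neg hχ hp _).symm
    _ = χ (-(π + ρ)) π := recip_of_primes hχ hp ht (fun τ h1 h2 h3 =>
        recip_prime_ne hχ hπ hp h1 h2 (hfac τ h1 h2 h3))
    _ = χ (-(π + ρ)) (-ρ) := chi_per hχ ht ⟨-1, by ring⟩
    _ = χ (-(π + ρ)) ρ := chi_neg hχ ht _
    _ = χ ρ (-(π + ρ)) := (recip_of_primes hχ hr ht (fun τ h1 h2 h3 =>
        recip_prime_ne hχ hρ hr h1 h2 (by rw [hch]; exact hfac τ h1 h2 h3))).symm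
    _ = χ ρ (π + ρ) := chi_neg hχ hr _
    _ = χ ρ π := chi_per hχ hr ⟨1, by ring⟩

lemma recip (hχ : IsCubicSymbol χ) {a b : Eis} (ha : Pri a) (hb : Pri b) (hab : IsCoprime a b) :
    χ a b = χ b a := by
  refine recip_of_primes hχ ha hb (fun τ hτ hτp hd => ?_)
  refine (recip_of_primes hχ hτp ha (fun σ hσ hσp hd2 => ?_)).symm
  refine recip_prime hχ hτ hτp hσ hσp ?_
  rintro rfl
  exact hτ.not_isUnit (hab.isUnit_of_dvd' hd2 hd)

end

/-- additive character -/
def ee (m c x : Eis) : ℂ := eE (((m * x : Eis) : ℂ) / (c : ℂ))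

lemma ee_add (m c x y : Eis) : ee m c (x + y) = ee m c x * ee m c y := by
  unfold ee; rw [← eE_add]; congr 1; push_cast; ring

lemma ee_mul (m c u x : Eis) : ee m c (u * x) = ee (u * m) c x := by
  unfold ee; congr 2; ring

lemma ee_dvd {m c x : Eis} (hc : c ≠ 0) (h : c ∣ m * x) : ee m c x = 1 := by
  obtain ⟨y, hy⟩ := h
  have hcc : (c : ℂ) ≠ 0 := by simpa using hc
  unfold ee; rw [hy]; push_cast; rw [mul_div_cancel_left₀ _ hcc]; exact eE_eis y

lemma ee_per (m c : Eis) (hc : c ≠ 0) : Per c (ee m c) := by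
  intro x y h
  have : x = y + (x - y) := by ring
  rw [this, ee_add, ee_dvd hc (h.mul_left m), mul_one]

lemma ee_cancel (m a c x : Eis) (ha : a ≠ 0) : ee (a * m) (a * c) x = ee m c x := by
  have hcc : (a : ℂ) ≠ 0 := by simpa using ha
  unfold ee; congr 1; push_cast; rw [mul_assoc, mul_div_mul_left _ _ hcc]

lemma ee_norm (m c x : Eis) : ‖ee m c x‖ = 1 := eE_norm _

lemma ee_conj (m c x : Eis) : (starRingEnd ℂ) (ee m c x) = ee m c (-x) := by
  unfold ee; rw [eE_conj]; congr 1; push_cast; ring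

lemma lam_coprime {π : Eis} (hπ : Prime π) (hp : Pri π) : ¬ π ∣ lam := by
  intro h
  have h3 := h.trans lam_dvd_three
  have := hp.isCoprime_three
  exact hπ.not_isUnit (this.isUnit_of_dvd' dvd_rfl h3)

lemma ee_nontriv {π ρ : Eis} (hπ : Prime π) (hp : Pri π) (hρ : ¬ π ∣ ρ) (j : ℕ) (hj : 1 ≤ j) :
    ∃ t, ee ρ (π ^ j) t ≠ 1 := by
  by_contra hcon
  push Not at hcon
  have h := eE_trivial (c := π ^ j) (m := ρ) (pow_ne_zero _ hπ.ne_zero) hcon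
  rcases hπ.dvd_or_dvd ((dvd_pow_self π (by omega)).trans h) with h | h
  · exact lam_coprime hπ hp h
  · exact hρ h

section
variable {χ : Eis → Eis → Eis}

lemma g_eq (m c : Eis) : g₃ χ m c = SS c (fun x => ((χ c x : Eis) : ℂ) * ee m c x) := rfl

lemma chi_ee_per (hχ : IsCubicSymbol χ) {c : Eis} (hc : Pri c) (m : Eis) :
    Per c (fun x => ((χ c x : Eis) : ℂ) * ee m c x) := by
  intro x y h
  simp only [chi_per hχ hc h, ee_per m c hc.ne_zero x y h]

lemma g_one (hχ : IsCubicSymbol χ) (m : Eis) : g₃ χ m 1 = 1 := by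
  rw [g_eq]
  have : SS 1 (fun x => ((χ 1 x : Eis) : ℂ) * ee m 1 x) = SS 1 (fun _ => 1) := by
    apply SS_congr
    intro x
    rw [hχ.one_bot, ee_dvd one_ne_zero (one_dvd _)]; simp
  rw [this, SS_const, Nm_one]; simp

lemma g_mul (hχ : IsCubicSymbol χ) {a b : Eis} (ha : Pri a) (hb : Pri b) (hab : IsCoprime a b) (m : Eis) :
    g₃ χ m (a * b) = (χ a b : ℂ) * (χ b a : ℂ) * (g₃ χ m a * g₃ χ m b) := by
  rw [g_eq, SS_crt ha.ne_zero hb.ne_zero hab (chi_ee_per hχ (ha.mul hb) m)]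
  have ha0 : (a : ℂ) ≠ 0 := by simpa using ha.ne_zero
  have hb0 : (b : ℂ) ≠ 0 := by simpa using hb.ne_zero
  have key : ∀ x, SS b (fun y => ((χ (a * b) (b * x + a * y) : Eis) : ℂ) * ee m (a * b) (b * x + a * y)) =
      ((χ a b : ℂ) * (χ b a : ℂ) * g₃ χ m b) * (((χ a x : Eis) : ℂ) * ee m a x) := by
    intro x
    rw [g_eq, mul_assoc, mul_comm (SS b _), ← mul_assoc, ← SS_const_mul]
    apply SS_congr
    intro y
    rw [hχ.mul_bot _ _ _ ha hb, chi_per hχ ha (a := b * x + a * y) (b := b * x) ⟨y, by ring⟩,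
      chi_per hχ hb (a := b * x + a * y) (b := a * y) ⟨x, by ring⟩, chi_mul hχ ha, chi_mul hχ hb, ee_add]
    have e1 : ee m (a * b) (b * x) = ee m a x := by
      rw [ee_mul, mul_comm a b, ee_cancel _ _ _ _ hb.ne_zero]
    have e2 : ee m (a * b) (a * y) = ee m b y := by
      rw [ee_mul, ee_cancel _ _ _ _ ha.ne_zero]
    rw [e1, e2]; push_cast; ring
  rw [SS_congr key, SS_const_mul, ← g_eq]; ring

lemma g_unit (hχ : IsCubicSymbol χ) {c u : Eis} (hc : Pri c) (hu : IsCoprime c u) (m : Eis) :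
    (χ c u : ℂ) * g₃ χ (u * m) c = g₃ χ m c := by
  rw [g_eq, g_eq, ← SS_unit (chi_ee_per hχ hc m) hu, ← SS_const_mul]
  apply SS_congr
  intro x
  simp only [chi_mul hχ hc, ee_mul]; push_cast; ring

lemma g_mul' (hχ : IsCubicSymbol χ) {a b : Eis} (ha : Pri a) (hb : Pri b) (hab : IsCoprime a b) (m : Eis) :
    g₃ χ m (a * b) = g₃ χ m a * g₃ χ (a * m) b := by
  rw [g_mul hχ ha hb hab, ← g_unit hχ hb hab.symm m, recip hχ ha hb hab]
  have h := chi_cube hχ hb hab.symm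
  have h' : ((χ b a : Eis) : ℂ) ^ 3 = 1 := by exact_mod_cast congrArg (Subtype.val) h
  linear_combination (g₃ χ m a * g₃ χ (a * m) b) * h'

lemma g_cube (hχ : IsCubicSymbol χ) {c u : Eis} (hc : Pri c) (hu : IsCoprime c u) (m : Eis) :
    g₃ χ (u ^ 3 * m) c = g₃ χ m c := by
  rw [← g_unit hχ hc (hu.pow_right (n := 3)) m, chi_pow hχ hc, chi_cube hχ hc hu]; simp

lemma g_norm_unit (hχ : IsCubicSymbol χ) {c u : Eis} (hc : Pri c) (hu : IsCoprime c u) (m : Eis) :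
    ‖g₃ χ (u * m) c‖ = ‖g₃ χ m c‖ := by
  rw [← g_unit hχ hc hu m, norm_mul]
  have h := chi_cube hχ hc hu
  have h' : ((χ c u : Eis) : ℂ) ^ 3 = 1 := by exact_mod_cast congrArg (Subtype.val) h
  have : ‖((χ c u : Eis) : ℂ)‖ ^ 3 = 1 := by rw [← norm_pow, h', norm_one]
  rw [(pow_eq_one_iff_of_nonneg (norm_nonneg _) (by norm_num)).1 this, one_mul]

/-- local sums -/
def LS (χ : Eis → Eis → Eis) (π : Eis) (k : ℕ) (ρ : Eis) : ℂ :=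
  SS π (fun x => ((χ π x : Eis) : ℂ) ^ k * ee ρ π x)

lemma LS_one (π ρ : Eis) : LS χ π 1 ρ = g₃ χ ρ π := by
  unfold LS; rw [g_eq]; simp

lemma LS_per (hχ : IsCubicSymbol χ) {π : Eis} (hp : Pri π) (k : ℕ) (ρ : Eis) :
    Per π (fun x => ((χ π x : Eis) : ℂ) ^ k * ee ρ π x) := by
  intro x y h
  simp only [chi_per hχ hp h, ee_per ρ π hp.ne_zero x y h]

lemma SS_conj {c : Eis} (hc : c ≠ 0) (f : Eis → ℂ) :
    (starRingEnd ℂ) (SS c f) = SS c (fun x => (starRingEnd ℂ) (f x)) := by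
  have := finite_quot hc
  unfold SS
  exact AddMonoidHom.map_finsum (starRingEnd ℂ).toAddMonoidHom (Set.toFinite _)

lemma SS_sub {c : Eis} (hc : c ≠ 0) (f g : Eis → ℂ) :
    SS c (fun x => f x - g x) = SS c f - SS c g := by
  have := finite_quot hc
  unfold SS
  exact finsum_sub_distrib (Set.toFinite _) (Set.toFinite _)

lemma chi_conj (hχ : IsCubicSymbol χ) {π : Eis} (hp : Pri π) (x : Eis) :
    (starRingEnd ℂ) ((χ π x : Eis) : ℂ) = ((χ π x : Eis) : ℂ) ^ 2 := by
  by_cases h0 : χ π x = 0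
  · simp [h0]
  have h := VV_cube (chi_VV hχ hp x) h0
  have h' : ((χ π x : Eis) : ℂ) ^ 3 = 1 := by exact_mod_cast congrArg (Subtype.val) h
  have hn : ‖((χ π x : Eis) : ℂ)‖ ^ 3 = 1 := by rw [← norm_pow, h', norm_one]
  have hn1 := (pow_eq_one_iff_of_nonneg (norm_nonneg _) (by norm_num)).1 hn
  have h0' : ((χ π x : Eis) : ℂ) ≠ 0 := by simpa using h0
  apply mul_left_cancel₀ h0'
  rw [Complex.mul_conj', hn1, ← pow_succ', h']; simp

lemma LS_two (hχ : IsCubicSymbol χ) {π : Eis} (hp : Pri π) (ρ : Eis) :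
    LS χ π 2 ρ = (starRingEnd ℂ) (g₃ χ ρ π) := by
  rw [g_eq, SS_conj hp.ne_zero]
  unfold LS
  rw [← SS_unit (LS_per hχ hp 2 ρ) (u := -1) isCoprime_one_right.neg_right]
  apply SS_congr
  intro x
  simp only [neg_one_mul, chi_neg hχ hp, map_mul, chi_conj hχ hp, ee_conj]

lemma LS_three (hχ : IsCubicSymbol χ) {π ρ : Eis} (hπ : Prime π) (hp : Pri π) (hρ : ¬ π ∣ ρ) :
    LS χ π 3 ρ = -1 := by
  classical
  have h1 : SS π (ee ρ π) = 0 := by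
    obtain ⟨t, ht⟩ := ee_nontriv hπ hp hρ 1 le_rfl
    rw [pow_one] at ht
    exact SS_zero_of_shift (ee_per ρ π hp.ne_zero) t ht (fun x => by rw [ee_add, mul_comm])
  have h2 : SS π (fun x => if π ∣ x then (1 : ℂ) else 0) = 1 := by
    unfold SS
    rw [finsum_eq_single _ (0 : Eis ⧸ Ideal.span {π})]
    · simp only []
      rw [if_pos]
      have := out_mk π 0
      simpa using this
    · intro d hd
      simp only []
      rw [if_neg]
      intro h
      apply hd
      rw [← mk_out' d, Ideal.Quotient.eq_zero_iff_mem, Ideal.mem_span_singleton]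
      exact h
  have h3 : LS χ π 3 ρ = SS π (fun x => ee ρ π x - if π ∣ x then (1 : ℂ) else 0) := by
    unfold LS
    apply SS_congr
    intro x
    by_cases hx : π ∣ x
    · rw [if_pos hx, (hχ.prime_eq_zero π x hπ hp).2 hx, ee_dvd hp.ne_zero (hx.mul_left _)]; simp
    · have h := chi_cube hχ hp (prime_coprime hπ hx)
      have h' : ((χ π x : Eis) : ℂ) ^ 3 = 1 := by exact_mod_cast congrArg (Subtype.val) h
      rw [if_neg hx, h']; simp
  rw [h3, SS_sub hp.ne_zero, h1, h2]; simp

lemma LS_red (hχ : IsCubicSymbol χ) {π ρ : Eis} (hp : Pri π) (k : ℕ) :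
    LS χ π (k + 4) ρ = LS χ π (k + 1) ρ := by
  unfold LS
  apply SS_congr
  intro x
  congr 1
  by_cases h0 : χ π x = 0
  · simp [h0]
  have h := VV_cube (chi_VV hχ hp x) h0
  have h' : ((χ π x : Eis) : ℂ) ^ 3 = 1 := by exact_mod_cast congrArg (Subtype.val) h
  linear_combination ((χ π x : Eis) : ℂ) ^ (k + 1) * h'

lemma g_prime_norm (hχ : IsCubicSymbol χ) {π ρ : Eis} (hπ : Prime π) (hp : Pri π) (hρ : ¬ π ∣ ρ) :
    g₃ χ ρ π * (starRingEnd ℂ) (g₃ χ ρ π) = (Nm π : ℂ) := by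
  let _ := KFfield hπ
  have := finite_quot hπ.ne_zero
  have := Fintype.ofFinite (KF π)
  have hinj : Function.Injective (Subring.subtype Eis) := Subtype.val_injective
  let cc := (mchar hχ hπ hp).ringHomComp (Subring.subtype Eis)
  have h1 : cc ≠ 1 := (MulChar.ringHomComp_ne_one_iff hinj).2 (mchar_ne_one hχ hπ hp)
  have hout : ∀ x y : Eis, π ∣ x - y → ee ρ π x = ee ρ π y := ee_per ρ π hp.ne_zero
  let P : AddChar (KF π) ℂ :=
    { toFun := fun d => ee ρ π d.out
      map_zero_eq_one' := by
        rw [hout _ 0 (by have := out_mk π 0; simpa using this)]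
        exact ee_dvd hp.ne_zero (by simp)
      map_add_eq_mul' := by
        intro a b
        rw [← ee_add]
        apply hout
        rw [← q_eq, mk_out', map_add, mk_out', mk_out'] }
  have hP : P.IsPrimitive := by
    apply AddChar.IsPrimitive.of_ne_one
    intro h
    obtain ⟨t, ht⟩ := ee_nontriv hπ hp hρ 1 le_rfl
    rw [pow_one] at ht
    apply ht
    have h2 := congrArg (fun c : AddChar (KF π) ℂ => c (Ideal.Quotient.mk _ t)) h
    rw [← hout _ t (out_mk π t)]
    exact h2
  have hg : g₃ χ ρ π = gaussSum cc P := by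
    rw [g_eq, gaussSum]; unfold SS
    rw [finsum_eq_sum_of_fintype]
    rfl
  have h3 := gaussSum_mul_gaussSum_eq_card h1 hP
  rw [← star_gaussSum_eq, card_KF] at h3
  rw [hg, Nm_eq]
  exact_mod_cast h3

lemma LS_norm (hχ : IsCubicSymbol χ) {π ρ : Eis} (hπ : Prime π) (hp : Pri π) (hρ : ¬ π ∣ ρ) (k : ℕ) :
    ‖LS χ π (k + 1) ρ‖ ≤ Real.sqrt (Nm π) := by
  have h0 : 1 ≤ Nm π := one_le_Nm hπ.ne_zero
  have hg : ‖g₃ χ ρ π‖ = Real.sqrt (Nm π) := by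
    have h := g_prime_norm hχ hπ hp hρ
    rw [Complex.mul_conj'] at h
    have h' : ‖g₃ χ ρ π‖ ^ 2 = Nm π := by exact_mod_cast h
    rw [← h', Real.sqrt_sq (norm_nonneg _)]
  induction k using Nat.strong_induction_on with
  | _ k ih =>
    match k, ih with
    | 0, _ => rw [zero_add, LS_one, hg]
    | 1, _ => rw [LS_two hχ hp, RCLike.norm_conj, hg]
    | 2, _ =>
      rw [LS_three hχ hπ hp hρ, norm_neg, norm_one]
      exact Real.one_le_sqrt.2 h0
    | k + 3, ih =>
      rw [LS_red hχ hp]; exact ih k (by omega)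

lemma g_pow_zero (hχ : IsCubicSymbol χ) {π ρ : Eis} (hπ : Prime π) (hp : Pri π) (hρ : ¬ π ∣ ρ) {m k : ℕ}
    (hk : m + 2 ≤ k) : g₃ χ (π ^ m * ρ) (π ^ k) = 0 := by
  obtain ⟨j, rfl⟩ := Nat.exists_eq_add_of_le hk
  obtain ⟨t, ht⟩ := ee_nontriv hπ hp hρ (1 + j) (by omega)
  rw [g_eq]
  refine SS_zero_of_shift (chi_ee_per hχ (hp.pow _) _) (π * t) ht (fun x => ?_)
  rw [ee_add, chi_pow_bot hχ hp, chi_pow_bot hχ hp, chi_per hχ hp (a := x + π * t) (b := x) ⟨t, by ring⟩, ee_mul]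
  have : ee (π * (π ^ m * ρ)) (π ^ (m + 2 + j)) t = ee ρ (π ^ (1 + j)) t := by
    rw [← ee_cancel ρ (π ^ (m + 1)) (π ^ (1 + j)) t (pow_ne_zero _ hπ.ne_zero)]
    congr 1 <;> ring
  rw [this]; ring

lemma g_pow_eq (hχ : IsCubicSymbol χ) {π : Eis} (ρ : Eis) (hπ : Prime π) (hp : Pri π) (m : ℕ) :
    g₃ χ (π ^ m * ρ) (π ^ (m + 1)) = (Nm π : ℂ) ^ m * LS χ π (m + 1) ρ := by
  have h : ∀ x, ((χ (π ^ (m + 1)) x : Eis) : ℂ) * ee (π ^ m * ρ) (π ^ (m + 1)) x =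
      ((χ π x : Eis) : ℂ) ^ (m + 1) * ee ρ π x := by
    intro x
    rw [chi_pow_bot hχ hp, pow_succ π m, ee_cancel _ _ _ _ (pow_ne_zero _ hπ.ne_zero)]; push_cast; rfl
  rw [g_eq, SS_congr h, pow_succ', SS_fiber hπ.ne_zero (pow_ne_zero _ hπ.ne_zero) (LS_per hχ hp _ _), Nm_pow]
  unfold LS; push_cast; ring

lemma g_pow_int (hχ : IsCubicSymbol χ) {π : Eis} (r : Eis) (hπ : Prime π) (hp : Pri π) (k : ℕ)
    (hk : ∃ a, IsCoprime π a ∧ χ π a ^ k ≠ 1) (h : π ^ k ∣ r) : g₃ χ r (π ^ k) = 0 := by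
  obtain ⟨a, ha, hk⟩ := hk
  have h1 := g_unit hχ (hp.pow k) ha.pow_left r
  have h2 : g₃ χ (a * r) (π ^ k) = g₃ χ r (π ^ k) := by
    rw [g_eq, g_eq]
    apply SS_congr
    intro x
    rw [ee_dvd (pow_ne_zero _ hπ.ne_zero) (h.mul_right x),
      ee_dvd (pow_ne_zero _ hπ.ne_zero) ((h.mul_left a).mul_right x)]
  rw [h2, chi_pow_bot hχ hp] at h1
  have h3 : (((χ π a ^ k : Eis) : ℂ) - 1) * g₃ χ r (π ^ k) = 0 := by linear_combination h1
  rcases mul_eq_zero.1 h3 with h4 | h4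
  · exfalso; apply hk
    apply Subtype.ext
    simpa using sub_eq_zero.1 h4
  · exact h4

end

lemma summable_Nm {t : ℝ} (ht : 1 < t) : Summable (fun x : Eis => Nm x ^ (-t)) := by
  rw [← coordEquiv.symm.toEquiv.summable_iff]
  have h := (EisensteinSeries.summable_one_div_norm_rpow (k := 2 * t) (by linarith)).mul_right ((1 / 2 : ℝ) ^ (-(2 * t)))
  refine Summable.of_nonneg_of_le (fun v => Real.rpow_nonneg (Nm_nonneg _) _) (fun v => ?_) h
  show Nm (coordEquiv.symm v) ^ (-t) ≤ _
  rw [coordEquiv_symm]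
  by_cases hv : v = 0
  · subst hv
    have h0 : Nm (mk ((0 : Fin 2 → ℤ) 0) ((0 : Fin 2 → ℤ) 1)) = 0 := by rw [Nm_mk]; simp
    rw [h0, Real.zero_rpow (by linarith)]
    positivity
  have hvn : 0 < ‖v‖ := norm_pos_iff.2 hv
  rw [← Real.mul_rpow hvn.le (by norm_num)]
  have h2 : (‖v‖ * (1 / 2)) ^ (-(2 * t)) = ((‖v‖ * (1 / 2)) ^ 2) ^ (-t) := by
    rw [← Real.rpow_natCast, ← Real.rpow_mul (by positivity)]; congr 1; push_cast; ring
  rw [h2]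
  refine Real.rpow_le_rpow_of_nonpos (by positivity) ?_ (by linarith)
  rw [Nm_mk]
  push_cast
  have h3 : ‖v‖ = max |(v 0 : ℝ)| |(v 1 : ℝ)| := by
    rw [EisensteinSeries.norm_eq_max_natAbs]
    push_cast
    simp [Nat.cast_natAbs]
  rw [h3]
  rcases max_choice |(v 0 : ℝ)| |(v 1 : ℝ)| with h | h <;> rw [h, mul_pow, sq_abs] <;>
    nlinarith [sq_nonneg ((v 0 : ℝ) - 2 * v 1), sq_nonneg (2 * (v 0 : ℝ) - v 1)]

section
variable {χ : Eis → Eis → Eis}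

lemma g_norm_le (hχ : IsCubicSymbol χ) {c : Eis} (hc : Pri c) (m : Eis) : ‖g₃ χ m c‖ ≤ Nm c := by
  rw [g_eq]
  apply SS_norm_le hc.ne_zero
  intro x
  rw [norm_mul, ee_norm, mul_one]
  exact VV_norm (chi_VV hχ hc x)

lemma factor_prime {π c : Eis} (hπ : Prime π) (hc : c ≠ 0) : ∃ k c', ¬ π ∣ c' ∧ c = π ^ k * c' := by
  obtain ⟨c', h1, h2⟩ := (FiniteMultiplicity.of_not_isUnit hπ.not_isUnit hc).exists_eq_pow_mul_and_not_dvd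
  exact ⟨_, c', h2, h1⟩

lemma g_pp_bound (hχ : IsCubicSymbol χ) {π ρ : Eis} (hπ : Prime π) (hp : Pri π) (hρ : ¬ π ∣ ρ) (m k : ℕ) :
    ‖g₃ χ (π ^ m * ρ) (π ^ k)‖ ≤ Nm (π ^ m) * Real.sqrt (Nm (π ^ k)) := by
  have h1 : 1 ≤ Nm π := one_le_Nm hπ.ne_zero
  rcases lt_trichotomy k (m + 1) with h | h | h
  · refine (g_norm_le hχ (hp.pow k) _).trans ?_
    have hk1 : 1 ≤ Nm (π ^ k) := one_le_Nm (pow_ne_zero _ hπ.ne_zero)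
    have hs : Nm (π ^ k) = Real.sqrt (Nm (π ^ k)) * Real.sqrt (Nm (π ^ k)) :=
      (Real.mul_self_sqrt (Nm_nonneg _)).symm
    have hs1 : 1 ≤ Real.sqrt (Nm (π ^ k)) := Real.one_le_sqrt.2 hk1
    have hkm : Nm (π ^ k) ≤ Nm (π ^ m) := by
      rw [Nm_pow, Nm_pow]; exact pow_le_pow_right₀ h1 (by omega)
    nlinarith
  · subst h
    rw [g_pow_eq hχ ρ hπ hp, norm_mul, norm_pow, Complex.norm_real, Real.norm_of_nonneg (Nm_nonneg _), Nm_pow]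
    have := LS_norm hχ hπ hp hρ m
    have h2 : Real.sqrt (Nm π) ≤ Real.sqrt (Nm (π ^ (m + 1))) := by
      apply Real.sqrt_le_sqrt
      rw [Nm_pow]; exact le_self_pow₀ h1 (by omega)
    exact mul_le_mul_of_nonneg_left (this.trans h2) (by positivity)
  · rw [g_pow_zero hχ hπ hp hρ (by omega), norm_zero]
    exact mul_nonneg (Nm_nonneg _) (Real.sqrt_nonneg _)

lemma g_bound (hχ : IsCubicSymbol χ) (n : ℕ) : ∀ {c r : Eis}, NmN c ≤ n → Pri c → r ≠ 0 →
    ‖g₃ χ r c‖ ≤ Nm r * Real.sqrt (Nm c) := by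
  induction n using Nat.strong_induction_on with
  | _ n ih =>
    intro c r hn hc hr
    by_cases h1 : c = 1
    · subst h1
      rw [g_one hχ, Nm_one]; simpa using one_le_Nm hr
    obtain ⟨π, hπ, hp, hd⟩ := hc.exists_prime h1
    obtain ⟨k, c', hc', rfl⟩ := factor_prime hπ hc.ne_zero
    obtain ⟨m, r', hr', rfl⟩ := factor_prime hπ hr
    have hk : k ≠ 0 := by
      rintro rfl; simp at hd; exact hc' hd
    have hpc : Pri c' := (hp.pow k).of_mul hc
    have hcop : IsCoprime π c' := prime_coprime hπ hc'
    have hr0 : r' ≠ 0 := right_ne_zero_of_mul hr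
    rw [g_mul' hχ (hp.pow k) hpc hcop.pow_left, norm_mul, g_norm_unit hχ hpc hcop.symm.pow_right,
      g_norm_unit hχ hpc hcop.symm.pow_right]
    have hlt : NmN c' < n := by
      rw [NmN_mul] at hn
      have h0 := NmN_pos hpc.ne_zero
      have h2 : 2 ≤ NmN (π ^ k) := by
        obtain ⟨j, rfl⟩ := Nat.exists_eq_succ_of_ne_zero hk
        rw [pow_succ, NmN_mul]
        have := NmN_pos (pow_ne_zero j hπ.ne_zero)
        have := prime_two_le hπ
        nlinarith
      nlinarith
    have hb := ih _ hlt (c := c') (r := r') le_rfl hpc hr0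
    have ha := g_pp_bound hχ hπ hp hr' m k
    rw [Nm_mul, Nm_mul, Real.sqrt_mul (Nm_nonneg _)]
    calc _ ≤ (Nm (π ^ m) * Real.sqrt (Nm (π ^ k))) * (Nm r' * Real.sqrt (Nm c')) :=
          mul_le_mul ha hb (norm_nonneg _) (mul_nonneg (Nm_nonneg _) (Real.sqrt_nonneg _))
      _ = _ := by ring

/-- summand -/
def tm (χ : Eis → Eis → Eis) (r : Eis) (s : ℂ) (c : Eis) : ℂ := g₃ χ r c * (Nm c : ℂ) ^ (-s)

lemma tm_norm (hχ : IsCubicSymbol χ) {c r : Eis} (s : ℂ) (hc : Pri c) (hr : r ≠ 0) :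
    ‖tm χ r s c‖ ≤ Nm r * Nm c ^ (-(s.re - 1 / 2)) := by
  have h0 : 0 < Nm c := Nm_pos hc.ne_zero
  unfold tm
  rw [norm_mul, Complex.norm_cpow_eq_rpow_re_of_pos h0]
  have hb := g_bound hχ _ le_rfl hc hr
  calc _ ≤ (Nm r * Real.sqrt (Nm c)) * Nm c ^ (-s).re := mul_le_mul_of_nonneg_right hb (by positivity)
    _ = _ := by
      rw [Real.sqrt_eq_rpow, mul_assoc, ← Real.rpow_add h0]; congr 2; simp; ring

/-- index set -/
def II (β : Eis) : Set Eis := {c | (3 : Eis) ∣ (c - 1) ∧ IsCoprime c β}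

lemma psi_eq (β r : Eis) (s : ℂ) : ψa χ β r s = ∑' c : II β, tm χ r s c.1 := rfl

lemma tm_summable (hχ : IsCubicSymbol χ) {r : Eis} {s : ℂ} (hs : 3 / 2 < s.re) (hr : r ≠ 0) (S : Set Eis)
    (hS : ∀ c ∈ S, Pri c) : Summable (fun c : S => tm χ r s c.1) := by
  apply Summable.of_norm_bounded (g := fun c : S => Nm r * Nm c.1 ^ (-(s.re - 1 / 2)))
  · exact ((summable_Nm (by linarith)).mul_left (Nm r)).subtype S
  · intro c
    exact tm_norm hχ s (hS c.1 c.2) hr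

end

lemma Nm_cpow_pow {π : Eis} (h : π ≠ 0) (k : ℕ) (s : ℂ) :
    (Nm (π ^ k) : ℂ) ^ s = (Nm π : ℂ) ^ ((k : ℂ) * s) := by
  have h0 := Nm_pos h
  have h1 : (Nm π : ℂ) ≠ 0 := by exact_mod_cast h0.ne'
  rw [Nm_pow, Complex.cpow_def_of_ne_zero h1, Complex.cpow_def_of_ne_zero (by push_cast; exact pow_ne_zero _ h1),
    ← Complex.ofReal_log h0.le, ← Complex.ofReal_log (by positivity), Real.log_pow]
  congr 1; push_cast; ring

lemma Nm_cpow_mul (a b : Eis) (s : ℂ) : (Nm (a * b) : ℂ) ^ s = (Nm a : ℂ) ^ s * (Nm b : ℂ) ^ s := by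
  rw [Nm_mul, Complex.ofReal_mul, Complex.mul_cpow_ofReal_nonneg (Nm_nonneg _) (Nm_nonneg _)]

section
variable {χ : Eis → Eis → Eis}

lemma tsum_split {X : Type*} (f : X → ℂ) (S A : Set X) (e : X → X) (hinj : Set.InjOn e A) (hsub : A ⊆ S)
    (hsub2 : ∀ c ∈ A, e c ∈ S) (hd : ∀ c ∈ A, e c ∉ A)
    (h0 : ∀ c ∈ S, c ∉ A → (∀ c' ∈ A, e c' ≠ c) → f c = 0)
    (hA : Summable (fun c : A => f c.1)) (hB : Summable (fun c : e '' A => f c.1)) :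
    ∑' c : S, f c.1 = ∑' c : A, f c.1 + ∑' c : A, f (e c.1) := by
  have hind : S.indicator f = (A ∪ e '' A).indicator f := by
    funext c
    by_cases hc : c ∈ S
    · rw [Set.indicator_of_mem hc]
      by_cases hc2 : c ∈ A ∪ e '' A
      · rw [Set.indicator_of_mem hc2]
      · rw [Set.indicator_of_notMem hc2]
        exact h0 c hc (fun h => hc2 (Or.inl h)) (fun c' h1 h2 => hc2 (Or.inr ⟨c', h1, h2⟩))
    · rw [Set.indicator_of_notMem hc, Set.indicator_of_notMem]
      rintro (h | ⟨c', h, rfl⟩)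
      · exact hc (hsub h)
      · exact hc (hsub2 c' h)
  have hdisj : Disjoint A (e '' A) := by
    rw [Set.disjoint_left]
    rintro c hc ⟨c', hc', rfl⟩
    exact hd c' hc' hc
  rw [tsum_subtype, hind, ← tsum_subtype, Summable.tsum_union_disjoint hdisj hA hB, tsum_image f hinj]

lemma psi_split (hχ : IsCubicSymbol χ) {π β r : Eis} {s : ℂ} (hs : 3 / 2 < s.re) (hr : r ≠ 0)
    (hπ : Prime π) (hp : Pri π) (hβ : IsCoprime π β) (K : ℕ) (hK : 1 ≤ K)
    (h0 : ∀ k, 1 ≤ k → k ≠ K → g₃ χ r (π ^ k) = 0) :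
    ψa χ β r s = ψa χ (π * β) r s +
      g₃ χ r (π ^ K) * (Nm (π ^ K) : ℂ) ^ (-s) * ψa χ (π * β) (π ^ K * r) s := by
  have hcopr : ∀ c ∈ II (π * β), IsCoprime c π ∧ IsCoprime c β := fun c hc =>
    ⟨hc.2.of_mul_right_left, hc.2.of_mul_right_right⟩
  have hmul : ∀ k, ∀ c ∈ II (π * β), g₃ χ r (π ^ k * c) = g₃ χ r (π ^ k) * g₃ χ (π ^ k * r) c := fun k c hc =>
    g_mul' hχ (hp.pow k) hc.1 (hcopr c hc).1.symm.pow_left r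
  have key := tsum_split (tm χ r s) (II β) (II (π * β)) (fun c => π ^ K * c)
    (fun a _ b _ h => mul_left_cancel₀ (pow_ne_zero K hπ.ne_zero) h)
    (fun c h => ⟨h.1, (hcopr c h).2⟩)
    (fun c h => ⟨(hp.pow K).mul h.1, (hβ.pow_left).mul_left (hcopr c h).2⟩)
    (fun c _ hc => by
      have h := (hcopr _ hc).1
      exact hπ.not_isUnit (h.isUnit_of_dvd' ((dvd_pow_self π (by omega)).mul_right c) dvd_rfl))
    (fun c hc h1 h2 => by
      have hcp : Pri c := hc.1
      obtain ⟨k, c', hc', rfl⟩ := factor_prime hπ hcp.ne_zero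
      have hpc : Pri c' := (hp.pow k).of_mul hcp
      have hmem : c' ∈ II (π * β) :=
        ⟨hpc, (prime_coprime hπ hc').symm.mul_right hc.2.of_mul_left_right⟩
      have hk0 : k ≠ 0 := by
        rintro rfl; apply h1; rw [pow_zero, one_mul]; exact hmem
      have hkK : k ≠ K := by
        rintro rfl; exact h2 c' hmem rfl
      unfold tm
      rw [hmul k c' hmem, h0 k (by omega) hkK, zero_mul, zero_mul])
    (tm_summable hχ hs hr _ (fun c hc => hc.1))
    (tm_summable hχ hs hr _ (by
      rintro c ⟨c', hc', rfl⟩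
      exact (hp.pow K).mul hc'.1))
  rw [psi_eq, psi_eq, psi_eq, key, ← tsum_mul_left]
  refine congrArg₂ _ rfl ?_
  refine tsum_congr (fun c => ?_)
  unfold tm
  rw [hmul K c.1 c.2, Nm_cpow_mul]; ring

lemma psi_cube (hχ : IsCubicSymbol χ) {π β r : Eis} (s : ℂ) :
    ψa χ (π * β) (π ^ 3 * r) s = ψa χ (π * β) r s := by
  rw [psi_eq, psi_eq]
  refine tsum_congr (fun c => ?_)
  unfold tm
  rw [g_cube hχ c.2.1 c.2.2.of_mul_right_left]

lemma exists_pow_ne (hχ : IsCubicSymbol χ) {π : Eis} (hπ : Prime π) (hp : Pri π) (k : ℕ) (hk : k = 1 ∨ k = 2) :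
    ∃ a, IsCoprime π a ∧ χ π a ^ k ≠ 1 := by
  obtain ⟨a, ha, ha1⟩ := exists_chi_ne_one hχ hπ hp
  refine ⟨a, prime_coprime hπ ha, ?_⟩
  rcases hk with rfl | rfl
  · rwa [pow_one]
  · intro h
    have h3 := chi_cube hχ hp (prime_coprime hπ ha)
    apply ha1
    rw [pow_succ, h, one_mul] at h3
    exact h3

variable (hχ : IsCubicSymbol χ) {π β ρ : Eis} {s : ℂ} (hs : 3 / 2 < s.re)
    (hπ : Prime π) (hp : Pri π) (hβ : IsCoprime π β) (hρ : ¬ π ∣ ρ)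

lemma ne_zero_of_ndvd (hρ : ¬ π ∣ ρ) : ρ ≠ 0 := by rintro rfl; exact hρ (dvd_zero _)

lemma psi_C (hχ : IsCubicSymbol χ) {π β ρ : Eis} {s : ℂ} (hs : 3 / 2 < s.re)
    (hπ : Prime π) (hp : Pri π) (hβ : IsCoprime π β) (hρ : ¬ π ∣ ρ) :
    ψa χ β ρ s = ψa χ (π * β) ρ s + g₃ χ ρ π * (Nm π : ℂ) ^ (-s) * ψa χ (π * β) (π * ρ) s := by
  have h := psi_split hχ (r := ρ) hs (ne_zero_of_ndvd hρ) hπ hp hβ 1 le_rfl (fun k hk hk1 => by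
    have := g_pow_zero hχ hπ hp hρ (m := 0) (k := k) (by omega)
    simpa using this)
  simpa using h

lemma psi_B (hχ : IsCubicSymbol χ) {π β ρ : Eis} {s : ℂ} (hs : 3 / 2 < s.re)
    (hπ : Prime π) (hp : Pri π) (hβ : IsCoprime π β) (hρ : ¬ π ∣ ρ) :
    ψa χ β (π * ρ) s = ψa χ (π * β) (π * ρ) s +
      (Nm π : ℂ) ^ (1 - 2 * s) * (starRingEnd ℂ) (g₃ χ ρ π) * ψa χ (π * β) ρ s := by
  have hN : (Nm π : ℂ) ≠ 0 := by exact_mod_cast (Nm_pos hπ.ne_zero).ne'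
  have h := psi_split hχ (r := π * ρ) hs (mul_ne_zero hπ.ne_zero (ne_zero_of_ndvd hρ)) hπ hp hβ 2 (by norm_num)
    (fun k hk hk1 => by
      by_cases h1 : k = 1
      · exact g_pow_int hχ _ hπ hp k (exists_pow_ne hχ hπ hp k (Or.inl h1)) (by rw [h1, pow_one]; exact dvd_mul_right _ _)
      · have := g_pow_zero hχ hπ hp hρ (m := 1) (k := k) (by omega)
        simpa using this)
  have hg := g_pow_eq hχ ρ hπ hp 1
  rw [pow_one, pow_one, LS_two hχ hp] at hg
  have e : π ^ 2 * (π * ρ) = π ^ 3 * ρ := by ring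
  rw [h, hg, e, psi_cube hχ, Nm_cpow_pow hπ.ne_zero]
  have e2 : (1 : ℂ) - 2 * s = 1 + ((2 : ℕ) : ℂ) * (-s) := by push_cast; ring
  rw [e2, Complex.cpow_add _ _ hN, Complex.cpow_one]; ring

lemma psi_A (hχ : IsCubicSymbol χ) {π β ρ : Eis} {s : ℂ} (hs : 3 / 2 < s.re)
    (hπ : Prime π) (hp : Pri π) (hβ : IsCoprime π β) (hρ : ¬ π ∣ ρ) :
    ψa χ (π * β) (π ^ 2 * ρ) s * (1 - (Nm π : ℂ) ^ ((2 : ℂ) - 3 * s)) = ψa χ β (π ^ 2 * ρ) s := by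
  have hN : (Nm π : ℂ) ≠ 0 := by exact_mod_cast (Nm_pos hπ.ne_zero).ne'
  have h := psi_split hχ (r := π ^ 2 * ρ) hs (mul_ne_zero (pow_ne_zero _ hπ.ne_zero) (ne_zero_of_ndvd hρ)) hπ hp hβ 3
    (by norm_num) (fun k hk hk1 => by
      by_cases h1 : k = 1 ∨ k = 2
      · exact g_pow_int hχ _ hπ hp k (exists_pow_ne hχ hπ hp k h1)
          ((pow_dvd_pow π (by omega)).trans (dvd_mul_right _ _))
      · exact g_pow_zero hχ hπ hp hρ (m := 2) (k := k) (by omega))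
  have hg := g_pow_eq hχ ρ hπ hp 2
  rw [LS_three hχ hπ hp hρ] at hg
  rw [h, hg, psi_cube hχ, Nm_cpow_pow hπ.ne_zero]
  have e2 : (2 : ℂ) - 3 * s = ((2 : ℕ) : ℂ) + ((3 : ℕ) : ℂ) * (-s) := by push_cast; ring
  rw [e2, Complex.cpow_add _ _ hN, Complex.cpow_natCast]; ring

lemma g_prime_norm' (hχ : IsCubicSymbol χ) {π ρ : Eis} {s : ℂ}
    (hπ : Prime π) (hp : Pri π) (hρ : ¬ π ∣ ρ) :
    (Nm π : ℂ) ^ (-s) * (Nm π : ℂ) ^ (1 - 2 * s) * (g₃ χ ρ π * (starRingEnd ℂ) (g₃ χ ρ π)) =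
      (Nm π : ℂ) ^ ((2 : ℂ) - 3 * s) := by
  have hN : (Nm π : ℂ) ≠ 0 := by exact_mod_cast (Nm_pos hπ.ne_zero).ne'
  rw [g_prime_norm hχ hπ hp hρ]
  have e : (2 : ℂ) - 3 * s = (-s + (1 - 2 * s)) + 1 := by ring
  rw [e, Complex.cpow_add _ _ hN, Complex.cpow_add _ _ hN, Complex.cpow_one]

lemma psi_iii (hχ : IsCubicSymbol χ) {π β ρ : Eis} {s : ℂ} (hs : 3 / 2 < s.re)
    (hπ : Prime π) (hp : Pri π) (hβ : IsCoprime π β) (hρ : ¬ π ∣ ρ) :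
    ψa χ (π * β) ρ s * (1 - (Nm π : ℂ) ^ ((2 : ℂ) - 3 * s)) =
      ψa χ β ρ s - (Nm π : ℂ) ^ (-s) * g₃ χ ρ π * ψa χ β (π * ρ) s := by
  rw [psi_B hχ hs hπ hp hβ hρ, psi_C hχ hs hπ hp hβ hρ]
  have := g_prime_norm' hχ (s := s) hπ hp hρ
  rw [← this]; ring

lemma psi_ii (hχ : IsCubicSymbol χ) {π β ρ : Eis} {s : ℂ} (hs : 3 / 2 < s.re)
    (hπ : Prime π) (hp : Pri π) (hβ : IsCoprime π β) (hρ : ¬ π ∣ ρ) :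
    ψa χ (π * β) (π * ρ) s * (1 - (Nm π : ℂ) ^ ((2 : ℂ) - 3 * s)) =
      ψa χ β (π * ρ) s - (Nm π : ℂ) ^ (1 - 2 * s) * (starRingEnd ℂ) (g₃ χ ρ π) * ψa χ β ρ s := by
  rw [psi_B hχ hs hπ hp hβ hρ, psi_C hχ hs hπ hp hβ hρ]
  have := g_prime_norm' hχ (s := s) hπ hp hρ
  rw [← this]; ring

end

lemma fin_step {X : Type*} (S : Set X) (hS : S.Finite) (F G H : X → ℂ) (k : ℂ)
    (h : ∀ x ∈ S, F x * k = G x + H x) :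
    (∑ᶠ x ∈ S, F x) * k = ∑ᶠ x ∈ S, G x + ∑ᶠ x ∈ S, H x := by
  rw [finsum_mem_eq_finite_toFinset_sum _ hS, finsum_mem_eq_finite_toFinset_sum _ hS,
    finsum_mem_eq_finite_toFinset_sum _ hS, Finset.sum_mul, ← Finset.sum_add_distrib]
  exact Finset.sum_congr rfl (fun x hx => h x (by simpa using hx))

lemma fin_union {X Y : Type*} (S : Set X) (hS : S.Finite) (e₁ e₂ : X → Y) (h₁ : Set.InjOn e₁ S)
    (h₂ : Set.InjOn e₂ S) (hd : ∀ x ∈ S, ∀ y ∈ S, e₁ x ≠ e₂ y) (F : Y → ℂ) :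
    ∑ᶠ y ∈ e₁ '' S ∪ e₂ '' S, F y = ∑ᶠ x ∈ S, F (e₁ x) + ∑ᶠ x ∈ S, F (e₂ x) := by
  rw [finsum_mem_union _ (hS.image _) (hS.image _), finsum_mem_image h₁, finsum_mem_image h₂]
  rw [Set.disjoint_left]
  rintro _ ⟨x, hx, rfl⟩ ⟨y, hy, h⟩
  exact hd x hx y hy h.symm

/-- primary divisors -/
def DD (α : Eis) : Set Eis := {d | (3 : Eis) ∣ (d - 1) ∧ d ∣ α}

lemma DD_one : DD 1 = {1} := by
  ext d
  constructor
  · rintro ⟨h1, h2⟩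
    exact Pri.eq_one h1 (isUnit_of_dvd_one h2)
  · rintro rfl
    exact ⟨pri_one, dvd_rfl⟩

lemma DD_mul {π a : Eis} (hπ : Prime π) (hp : Pri π) :
    DD (π * a) = (fun d => d) '' DD a ∪ (fun d => π * d) '' DD a := by
  ext d
  constructor
  · rintro ⟨h1, h2⟩
    by_cases h : π ∣ d
    · right
      obtain ⟨d', rfl⟩ := h
      exact ⟨d', ⟨hp.of_mul h1, (mul_dvd_mul_iff_left hπ.ne_zero).1 h2⟩, rfl⟩
    · left
      exact ⟨d, ⟨h1, (prime_coprime hπ h).symm.dvd_of_dvd_mul_left h2⟩, rfl⟩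
  · rintro (⟨d', ⟨h1, h2⟩, rfl⟩ | ⟨d', ⟨h1, h2⟩, rfl⟩)
    · exact ⟨h1, h2.mul_left _⟩
    · exact ⟨hp.mul h1, mul_dvd_mul_left _ h2⟩

lemma DD_finite {a : Eis} (ha : Pri a) : (DD a).Finite := by
  refine Pri.induction (P := fun a => (DD a).Finite) ?_ ?_ ha
  · rw [DD_one]; exact Set.finite_singleton _
  · intro π c hπ hp _ ih
    rw [DD_mul hπ hp]; exact (ih.image _).union (ih.image _)

/-- pairs -/
def TT (α r : Eis) : Set (Eis × Eis) :=
  {p : Eis × Eis | (3 : Eis) ∣ (p.1 - 1) ∧ p.1 ∣ α ∧ p.1 * p.2 = α * r}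

lemma TT_finite {a : Eis} (ha : Pri a) (r : Eis) : (TT a r).Finite := by
  refine Set.Finite.of_finite_image (f := Prod.fst) ((DD_finite ha).subset ?_) ?_
  · rintro _ ⟨p, hp, rfl⟩
    exact ⟨hp.1, hp.2.1⟩
  · rintro ⟨d, e⟩ h1 ⟨d', e'⟩ h2 (rfl : d = d')
    have h3 : d * e = d * e' := h1.2.2.trans h2.2.2.symm
    have h4 : d ≠ 0 := Pri.ne_zero h1.1
    rw [mul_left_cancel₀ h4 h3]

lemma TT_one (r : Eis) : TT 1 r = {(1, r)} := by
  ext ⟨d, e⟩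
  constructor
  · rintro ⟨h1, h2, h3⟩
    have : d = 1 := Pri.eq_one h1 (isUnit_of_dvd_one h2)
    subst this
    simpa using h3
  · intro h
    obtain ⟨rfl, rfl⟩ := Prod.mk.inj h
    exact ⟨pri_one, dvd_rfl, rfl⟩

lemma TT_shift (k a r : Eis) : TT a (k * r) = (fun p : Eis × Eis => (p.1, k * p.2)) '' TT a r := by
  ext ⟨d, e⟩
  constructor
  · rintro ⟨h1, h2, h3⟩
    have h4 : d ≠ 0 := Pri.ne_zero h1
    obtain ⟨x, hx⟩ := h2
    refine ⟨(d, x * r), ⟨h1, ⟨x, hx⟩, ?_⟩, ?_⟩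
    · show d * (x * r) = a * r
      rw [hx]; ring
    · have : d * e = d * (k * (x * r)) := by
        refine h3.trans ?_; rw [hx]; ring
      show (d, k * (x * r)) = (d, e)
      rw [mul_left_cancel₀ h4 this]
  · rintro ⟨⟨d', e'⟩, ⟨h1, h2, h3⟩, h⟩
    obtain ⟨rfl, rfl⟩ := Prod.mk.inj h
    refine ⟨h1, h2, ?_⟩
    change d' * e' = a * r at h3
    show d' * (k * e') = a * (k * r)
    linear_combination k * h3

lemma TT_mul {π a r : Eis} (hπ : Prime π) (hp : Pri π) :
    TT (π * a) r = (fun p : Eis × Eis => (p.1, π * p.2)) '' TT a r ∪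
      (fun p : Eis × Eis => (π * p.1, p.2)) '' TT a r := by
  rw [← TT_shift]
  ext ⟨d, e⟩
  constructor
  · rintro ⟨h1, h2, h3⟩
    change d * e = π * a * r at h3
    by_cases h : π ∣ d
    · right
      obtain ⟨d', rfl⟩ := h
      refine ⟨(d', e), ⟨hp.of_mul h1, (mul_dvd_mul_iff_left hπ.ne_zero).1 h2, ?_⟩, rfl⟩
      apply mul_left_cancel₀ hπ.ne_zero
      linear_combination h3
    · left
      exact ⟨h1, (prime_coprime hπ h).symm.dvd_of_dvd_mul_left h2, by linear_combination h3⟩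
  · rintro (⟨h1, h2, h3⟩ | ⟨⟨d', e'⟩, ⟨h1, h2, h3⟩, h⟩)
    · exact ⟨h1, h2.mul_left _, by linear_combination h3⟩
    · obtain ⟨rfl, rfl⟩ := Prod.mk.inj h
      exact ⟨hp.mul h1, mul_dvd_mul_left _ h2, by linear_combination π * h3⟩

/-- prime divisors -/
def PP (α : Eis) : Set Eis := {p : Eis | Prime p ∧ (3 : Eis) ∣ (p - 1) ∧ p ∣ α}

lemma Delta_one (s : ℂ) : Δprod 1 s = 1 := by
  have : {p : Eis | Prime p ∧ (3 : Eis) ∣ (p - 1) ∧ p ∣ 1} = ∅ := by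
    ext p
    simp only [Set.mem_setOf_eq, Set.mem_empty_iff_false, iff_false]
    rintro ⟨h1, _, h3⟩
    exact h1.not_isUnit (isUnit_of_dvd_one h3)
  rw [Δprod, this, finprod_mem_empty]

lemma Delta_mul {π a : Eis} (hπ : Prime π) (hp : Pri π) (ha : Pri a) (h : ¬ π ∣ a) (s : ℂ) :
    Δprod (π * a) s = (1 - (Nm π : ℂ) ^ ((2 : ℂ) - 3 * s)) * Δprod a s := by
  have he : {p : Eis | Prime p ∧ (3 : Eis) ∣ (p - 1) ∧ p ∣ π * a} = insert π (PP a) := by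
    ext p
    constructor
    · rintro ⟨h1, h2, h3⟩
      rcases h1.dvd_or_dvd h3 with h4 | h4
      · left; exact prime_eq_of_dvd h1 hπ h2 hp h4
      · right; exact ⟨h1, h2, h4⟩
    · rintro (rfl | ⟨h1, h2, h3⟩)
      · exact ⟨hπ, hp, dvd_mul_right _ _⟩
      · exact ⟨h1, h2, h3.mul_left _⟩
  have hf : (PP a).Finite := (DD_finite ha).subset (fun p hp => ⟨hp.2.1, hp.2.2⟩)
  rw [Δprod, he, finprod_mem_insert _ (fun hm => h hm.2.2) hf]
  rfl

section
variable {χ : Eis → Eis → Eis}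

lemma main_ind (hχ : IsCubicSymbol χ) {μ : Eis → ℤ} (hμ : IsMoebius μ) {s : ℂ} (hs : 3 / 2 < s.re)
    {α : Eis} (hα : Pri α) : ∀ β r : Eis, Squarefree α → IsCoprime α (β * r) →
    (ψa χ (α * β) (α ^ 2 * r) s * Δprod α s = ψa χ β (α ^ 2 * r) s) ∧
    (ψa χ (α * β) (α * r) s * Δprod α s =
      ∑ᶠ p ∈ TT α r,
        (μ p.1 : ℂ) * (Nm p.1 : ℂ) ^ ((1 : ℂ) - 2 * s) *
          (starRingEnd ℂ) (g₃ χ p.2 p.1) * ψa χ β p.2 s) ∧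
    (ψa χ (α * β) r s * Δprod α s =
      ∑ᶠ d ∈ DD α,
        (μ d : ℂ) * (Nm d : ℂ) ^ (-s) * g₃ χ r d * ψa χ β (r * d) s) := by
  refine Pri.induction (P := fun α => ∀ β r : Eis, Squarefree α → IsCoprime α (β * r) →
    (ψa χ (α * β) (α ^ 2 * r) s * Δprod α s = ψa χ β (α ^ 2 * r) s) ∧
    (ψa χ (α * β) (α * r) s * Δprod α s =
      ∑ᶠ p ∈ TT α r,
        (μ p.1 : ℂ) * (Nm p.1 : ℂ) ^ ((1 : ℂ) - 2 * s) *
          (starRingEnd ℂ) (g₃ χ p.2 p.1) * ψa χ β p.2 s) ∧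
    (ψa χ (α * β) r s * Δprod α s =
      ∑ᶠ d ∈ DD α,
        (μ d : ℂ) * (Nm d : ℂ) ^ (-s) * g₃ χ r d * ψa χ β (r * d) s)) ?_ ?_ hα
  · intro β r _ _
    refine ⟨?_, ?_, ?_⟩
    · rw [Delta_one]; simp
    · rw [Delta_one, TT_one, finsum_mem_singleton, hμ.isUnit 1 isUnit_one, Nm_one, g_one hχ]; simp
    · rw [Delta_one, DD_one, finsum_mem_singleton, hμ.isUnit 1 isUnit_one, Nm_one, g_one hχ]; simp
  · intro π a hπ hp ha ih β r hsf hcop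
    have hπa : ¬ π ∣ a := by
      rintro ⟨x, rfl⟩
      exact hπ.not_isUnit (hsf π ⟨x, by ring⟩)
    have hsa : Squarefree a := hsf.squarefree_of_dvd (dvd_mul_left a π)
    have h1 : IsCoprime π (β * r) := hcop.of_mul_left_left
    have h2 : IsCoprime a (β * r) := hcop.of_mul_left_right
    have hπβ : IsCoprime π β := h1.of_mul_right_left
    have hndvd : ∀ x, IsCoprime π x → ¬ π ∣ x := fun x hx hd =>
      hπ.not_isUnit (hx.isUnit_of_dvd' dvd_rfl hd)
    have hπr : IsCoprime π r := h1.of_mul_right_right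
    have hcπa : IsCoprime π a := prime_coprime hπ hπa
    have haβ : IsCoprime a β := h2.of_mul_right_left
    have har : IsCoprime a r := h2.of_mul_right_right
    have eβ : π * a * β = a * (π * β) := by ring
    have hdco : ∀ d ∈ DD a, IsCoprime π d := fun d hd => hcπa.of_isCoprime_of_dvd_right hd.2
    rw [Delta_mul hπ hp ha hπa, eβ]
    refine ⟨?_, ?_, ?_⟩
    · have h := (ih (π * β) (π ^ 2 * r) hsa
        ((hcπa.symm.mul_right haβ).mul_right ((hcπa.symm.pow_right).mul_right har))).1
      have hA := psi_A hχ hs hπ hp hπβ (hndvd (a ^ 2 * r) (hcπa.pow_right.mul_right hπr))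
      have e1 : (π * a) ^ 2 * r = π ^ 2 * (a ^ 2 * r) := by ring
      have e2 : a ^ 2 * (π ^ 2 * r) = π ^ 2 * (a ^ 2 * r) := by ring
      rw [e2] at h
      rw [e1, ← hA, ← h]; ring
    · have h := (ih (π * β) (π * r) hsa
        ((hcπa.symm.mul_right haβ).mul_right (hcπa.symm.mul_right har))).2.1
      have e1 : π * a * r = a * (π * r) := by ring
      have inj1 : Set.InjOn (fun p : Eis × Eis => (p.1, π * p.2)) (TT a r) := by
        rintro ⟨d, e⟩ _ ⟨d', e'⟩ _ hh
        obtain ⟨q1, q2⟩ := Prod.mk.inj hh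
        exact Prod.ext q1 (mul_left_cancel₀ hπ.ne_zero q2)
      have inj2 : Set.InjOn (fun p : Eis × Eis => (π * p.1, p.2)) (TT a r) := by
        rintro ⟨d, e⟩ _ ⟨d', e'⟩ _ hh
        obtain ⟨q1, q2⟩ := Prod.mk.inj hh
        exact Prod.ext (mul_left_cancel₀ hπ.ne_zero q1) q2
      rw [TT_mul hπ hp, fin_union _ (TT_finite ha r) _ _ inj1 inj2, e1,
        mul_comm (1 - (Nm π : ℂ) ^ ((2 : ℂ) - 3 * s)), ← mul_assoc, h, TT_shift, finsum_mem_image inj1]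
      · refine fin_step _ (TT_finite ha r) _ _ _ _ ?_
        rintro ⟨d, e⟩ ⟨q1, q2, q3⟩
        change d * e = a * r at q3
        have hd : IsCoprime π d := hdco d ⟨q1, q2⟩
        have he : ¬ π ∣ e := fun hh => hndvd (a * r) (hcπa.mul_right hπr) (q3 ▸ hh.mul_left d)
        have key := psi_ii hχ hs hπ hp hπβ he
        simp only []
        rw [hμ.prime_mul π d hπ (hndvd d hd), Nm_cpow_mul, g_mul' hχ hp q1 hd, map_mul, mul_assoc, key]
        push_cast; ring
      · rintro ⟨d, e⟩ hde ⟨d', e'⟩ _ hh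
        obtain ⟨q1, q2⟩ := Prod.mk.inj hh
        exact hndvd d (hdco d ⟨hde.1, hde.2.1⟩) ⟨d', q1⟩
    · have h := (ih (π * β) r hsa
        ((hcπa.symm.mul_right haβ).mul_right har)).2.2
      rw [DD_mul hπ hp, fin_union _ (DD_finite ha) _ _ (fun x _ y _ hh => hh)
        (fun x _ y _ hh => mul_left_cancel₀ hπ.ne_zero hh),
        mul_comm (1 - (Nm π : ℂ) ^ ((2 : ℂ) - 3 * s)), ← mul_assoc, h]
      · refine fin_step _ (DD_finite ha) _ _ _ _ ?_
        intro d hdd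
        have hd : IsCoprime π d := hdco d hdd
        have hρ : ¬ π ∣ r * d := hndvd _ (hπr.mul_right hd)
        have key := psi_iii hχ hs hπ hp hπβ hρ
        have e1 : r * (π * d) = π * (r * d) := by ring
        rw [hμ.prime_mul π d hπ (hndvd d hd), Nm_cpow_mul, mul_comm π d, g_mul' hχ hdd.1 hp hd.symm,
          mul_comm d π, e1, mul_comm d r, mul_assoc, key]
        push_cast; ring
      · intro d hd d' _ hh
        exact hndvd d (hdco d hd) ⟨d', hh⟩

end

/-- Lemma 6.1, removal of coprimality conditions: for `Re(s) > 3/2`,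
`α` squarefree `≡ 1 (mod 3)` and `(α, βr) = 1`, the three identities relating
`ψ_{αβ}` to `ψ_β`.  In (ii) the sum over `d ∣ α`, `d ≡ 1 (mod 3)` is written as a sum
over pairs `(d, e)` with `d·e = α·r` (so that `e = αr/d`). -/
theorem psi_remove_coprimality
    (χ : Eis → Eis → Eis) (hχ : IsCubicSymbol χ)
    (μ : Eis → ℤ) (hμ : IsMoebius μ)
    (s : ℂ) (hs : 3/2 < s.re)
    (α β r : Eis) (hα : (3 : Eis) ∣ (α - 1)) (hβ : (3 : Eis) ∣ (β - 1))
    (hsf : Squarefree α) (hcop : IsCoprime α (β * r)) :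
    (ψa χ (α * β) (α ^ 2 * r) s * Δprod α s = ψa χ β (α ^ 2 * r) s) ∧
    (ψa χ (α * β) (α * r) s * Δprod α s =
      ∑ᶠ p ∈ {p : Eis × Eis | (3 : Eis) ∣ (p.1 - 1) ∧ p.1 ∣ α ∧ p.1 * p.2 = α * r},
        (μ p.1 : ℂ) * (Nm p.1 : ℂ) ^ ((1 : ℂ) - 2 * s) *
          (starRingEnd ℂ) (g₃ χ p.2 p.1) * ψa χ β p.2 s) ∧
    (ψa χ (α * β) r s * Δprod α s =
      ∑ᶠ d ∈ {d : Eis | (3 : Eis) ∣ (d - 1) ∧ d ∣ α},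
        (μ d : ℂ) * (Nm d : ℂ) ^ (-s) * g₃ χ r d * ψa χ β (r * d) s) := by
  exact main_ind hχ hμ hs hα β r hsf hcop

end CubicPaper
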